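/- There exists N such that for every odd integer k > 5 and every integer n ≥ N with n ≡ 3, 5, 24, or 26 (mod 28), the number of isomorphism classes of cyclic (K_{2nk+k}, C_k)-designs satisfies NC(2nk+k, k) ≥ 3.35^n / k. -/

import Mathlib

namespace CCS

/-- A block: a set of edges of the complete graph on `ZMod v`. -/
abbrev Block (v : ℕ) := Finset (Sym2 (ZMod v))

/-- The edge set of the closed tuple `c = (c 0, c 1, …, c (k-1))`. -/
def edgesOf {v k : ℕ} (c : Fin k → ZMod v) : Block v :=
  Finset.image (fun i : Fin k => s(c i, c ⟨(i.1 + 1) % k, Nat.mod_lt _ i.pos⟩)) Finset.univ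

/-- `E` is the edge set of a `k`-cycle on `ZMod v`. Since for `k ≥ 3` the edge set
determines the closed tuple up to rotation and reversal, a `k`-cycle is identified
with its edge set. -/
def IsCycleBlock (v k : ℕ) (E : Block v) : Prop :=
  ∃ c : Fin k → ZMod v, Function.Injective c ∧ E = edgesOf c

/-- The translate `E + z` of a cycle. -/
def translateBlock {v : ℕ} (E : Block v) (z : ZMod v) : Block v :=
  E.image (Sym2.map (· + z))

/-- A `(K_v, C_k)`-design: a set of `k`-cycles whose edge sets partition the edges of `K_v`. -/
def IsDesign (v k : ℕ) (B : Set (Block v)) : Prop :=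
  (∀ E ∈ B, IsCycleBlock v k E) ∧
  ∀ e : Sym2 (ZMod v), ¬ e.IsDiag → ∃! E, E ∈ B ∧ e ∈ E

/-- A cyclic `(K_v, C_k)`-design. -/
def IsCyclicDesign (v k : ℕ) (B : Set (Block v)) : Prop :=
  IsDesign v k B ∧ ∀ E ∈ B, ∀ z : ZMod v, translateBlock E z ∈ B

/-- Two designs are isomorphic if a bijection of `ZMod v` maps one onto the other. -/
def Isomorphic {v : ℕ} (B B' : Set (Block v)) : Prop :=
  ∃ f : ZMod v ≃ ZMod v, B' = (fun E : Block v => E.image (Sym2.map f)) '' B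

/-- `NC v k`: the number of cyclic `(K_v, C_k)`-designs up to isomorphism. -/
noncomputable def NC (v k : ℕ) : ℕ :=
  Nat.card (Quot fun B B' : {B : Set (Block v) // IsCyclicDesign v k B} =>
    Isomorphic B.1 B'.1)

/-- The type of a cycle: the order of its stabilizer under translations. -/
noncomputable def cycleType {v : ℕ} (E : Block v) : ℕ :=
  Nat.card {z : ZMod v // translateBlock E z = E}

/-- The two differences `±(a-b)` arising from an edge `{a,b}`. -/
def edgeDiffs {v : ℕ} : Sym2 (ZMod v) → Multiset (ZMod v) :=
  Sym2.lift ⟨fun a b => {a - b, b - a}, fun a b => by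
    show (a-b) ::ₘ {b-a} = (b-a) ::ₘ {a-b}; exact Multiset.cons_swap _ _ _⟩

/-- The multiset of the `2k` differences arising from the `k` edges of a cycle.
For a cycle of type `d` this is `d` copies of the list `∂C` of partial differences. -/
def fullDiffs {v : ℕ} (E : Block v) : Multiset (ZMod v) :=
  E.val.bind edgeDiffs

/-- The multiset `∂C` of partial differences of a cycle: each difference is counted
with multiplicity equal to its multiplicity among the `2k` edge differences divided
by the type of the cycle. -/
noncomputable def partialDiffs {v : ℕ} (E : Block v) : Multiset (ZMod v) :=
  (fullDiffs E).toFinset.val.bind fun x =>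
    Multiset.replicate ((fullDiffs E).count x / cycleType E) x

/-- A `(K_v, C_k)`-difference system: a set of `k`-cycles whose partial differences
cover every nonzero element of `ZMod v` exactly once. -/
def IsDifferenceSystem (v k : ℕ) (F : Finset (Block v)) : Prop :=
  (∀ E ∈ F, IsCycleBlock v k E) ∧
  ∀ x : ZMod v, (F.val.bind partialDiffs).count x = if x = 0 then 0 else 1

section CyclicDesigns

/-- A closed `k`-cycle on `ZMod v`, traversed periodically, which is invariant under the
translation by `shift`: moving `len` steps along the cycle amounts to adding `shift`. -/
structure BaseCycle (v k : ℕ) where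
  vtx : ℕ → ZMod v
  len : ℕ
  shift : ZMod v
  len_pos : 0 < len
  vtx_add_len : ∀ j, vtx (j + len) = vtx j + shift
  vtx_add_period : ∀ j, vtx (j + k) = vtx j
  inj : Set.InjOn vtx (Set.Iio k)

namespace BaseCycle

variable {v k : ℕ}

/-- The edge set of a base cycle. -/
def block (c : BaseCycle v k) : Block v := edgesOf fun j : Fin k => c.vtx j

/-- The difference of the `j`-th edge of a base cycle. -/
def diff (c : BaseCycle v k) (j : ℕ) : ZMod v := c.vtx (j + 1) - c.vtx j

theorem vtx_mod (c : BaseCycle v k) (j : ℕ) : c.vtx (j % k) = c.vtx j := by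
  have h : ∀ q r, c.vtx (r + k * q) = c.vtx r := by
    intro q
    induction q with
    | zero => simp
    | succ q ih => intro r; rw [Nat.mul_succ, ← Nat.add_assoc, c.vtx_add_period, ih]
  rw [← h (j / k) (j % k), Nat.mod_add_div]

theorem vtx_eq_iff (c : BaseCycle v k) (hk : 0 < k) {i j : ℕ} :
    c.vtx i = c.vtx j ↔ i % k = j % k := by
  constructor
  · intro h
    rw [← c.vtx_mod i, ← c.vtx_mod j] at h
    exact c.inj (Nat.mod_lt _ hk) (Nat.mod_lt _ hk) h
  · intro h
    rw [← c.vtx_mod i, h, c.vtx_mod]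

theorem mem_block (c : BaseCycle v k) (hk : 0 < k) {e : Sym2 (ZMod v)} :
    e ∈ c.block ↔ ∃ j, e = s(c.vtx j, c.vtx (j + 1)) := by
  simp only [block, edgesOf, Finset.mem_image, Finset.mem_univ, true_and]
  constructor
  · rintro ⟨j, rfl⟩
    exact ⟨j, by rw [c.vtx_mod]⟩
  · rintro ⟨j, rfl⟩
    refine ⟨⟨j % k, Nat.mod_lt _ hk⟩, ?_⟩
    have h : c.vtx (j % k + 1) = c.vtx (j + 1) := by
      rw [c.vtx_eq_iff hk]
      simp
    simp only [c.vtx_mod, h]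

theorem diff_ne_zero (c : BaseCycle v k) (hk : 2 ≤ k) (j : ℕ) : c.diff j ≠ 0 := by
  intro h
  rw [diff, sub_eq_zero, c.vtx_eq_iff (by omega)] at h
  have h1 : (1 : ℕ) ≡ 0 [MOD k] := Nat.ModEq.add_left_cancel' j (show j + 1 ≡ j + 0 [MOD k] from h)
  have := Nat.ModEq.eq_of_lt_of_lt h1 (by omega) (by omega)
  omega

theorem isCycleBlock_block (c : BaseCycle v k) : IsCycleBlock v k c.block :=
  ⟨_, fun i j h => Fin.ext (c.inj i.2 j.2 h), rfl⟩

theorem vtx_add_mul_len (c : BaseCycle v k) (r q : ℕ) :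
    c.vtx (r + c.len * q) = c.vtx r + q • c.shift := by
  induction q with
  | zero => simp
  | succ q ih => rw [Nat.mul_succ, ← Nat.add_assoc, c.vtx_add_len, ih, succ_nsmul, add_assoc]

theorem vtx_eq_mod_len (c : BaseCycle v k) (j : ℕ) :
    c.vtx j = c.vtx (j % c.len) + (j / c.len) • c.shift := by
  rw [← vtx_add_mul_len, Nat.mod_add_div]

theorem diff_mod_len (c : BaseCycle v k) (j : ℕ) : c.diff (j % c.len) = c.diff j := by
  have h := c.vtx_add_mul_len (j % c.len + 1) (j / c.len)
  have h' : j % c.len + 1 + c.len * (j / c.len) = j + 1 := by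
    have := Nat.mod_add_div j c.len
    omega
  rw [h'] at h
  rw [diff, diff, h, c.vtx_eq_mod_len j]
  ring

end BaseCycle

variable {v k : ℕ}

theorem translateBlock_add (E : Block v) (y z : ZMod v) :
    translateBlock (translateBlock E y) z = translateBlock E (y + z) := by
  rw [translateBlock, translateBlock, translateBlock, Finset.image_image]
  congr 1
  ext e
  induction e with
  | _ a b => simp [add_assoc]

theorem mem_translateBlock {E : Block v} {z a b : ZMod v} :
    s(a, b) ∈ translateBlock E z ↔ s(a - z, b - z) ∈ E := by
  simp only [translateBlock, Finset.mem_image]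
  constructor
  · rintro ⟨e, he, h⟩
    induction e with
    | _ x y =>
      rw [Sym2.map_mk, Sym2.eq_iff] at h
      rcases h with ⟨rfl, rfl⟩ | ⟨rfl, rfl⟩
      · simpa using he
      · rw [Sym2.eq_swap]; simpa using he
  · intro h
    exact ⟨_, h, by simp⟩

theorem isCycleBlock_translateBlock {E : Block v} (h : IsCycleBlock v k E) (z : ZMod v) :
    IsCycleBlock v k (translateBlock E z) := by
  obtain ⟨c, hc, rfl⟩ := h
  refine ⟨fun j => c j + z, fun i j h => hc (add_right_cancel h), ?_⟩
  simp only [translateBlock, edgesOf, Finset.image_image]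
  rfl

theorem BaseCycle.translateBlock_block_shift (c : BaseCycle v k) (hk : 0 < k) (q : ℕ) :
    translateBlock c.block (q • c.shift) = c.block := by
  refine Finset.eq_of_subset_of_card_le ?_ ?_
  · intro e he
    induction e with
    | _ a b =>
      rw [mem_translateBlock, c.mem_block hk] at he
      obtain ⟨j, hj⟩ := he
      rw [c.mem_block hk]
      refine ⟨j + c.len * q, ?_⟩
      rw [show j + c.len * q + 1 = j + 1 + c.len * q by ring, c.vtx_add_mul_len,
        c.vtx_add_mul_len]
      rw [Sym2.eq_iff] at hj ⊢
      simpa [sub_eq_iff_eq_add] using hj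
  · rw [translateBlock, Finset.card_image_of_injective]
    exact Sym2.map.injective (add_left_injective _)

/-- The set of all translates of a family of base cycles. -/
def translates {ι : Type*} (c : ι → BaseCycle v k) : Set (Block v) :=
  {E | ∃ a z, E = translateBlock (c a).block z}

theorem isCyclicDesign_translates [NeZero v] (hk : 2 ≤ k) {ι : Type*} [Fintype ι]
    (c : ι → BaseCycle v k) (hcard : 2 * ∑ a, (c a).len ≤ v - 1)
    (hcover : ∀ d : ZMod v, d ≠ 0 → ∃ a j, d = (c a).diff j ∨ d = -(c a).diff j) :
    IsCyclicDesign v k (translates c) := by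
  have hk0 : 0 < k := by omega
  let g : (Σ a, Fin (c a).len) × Bool → {d : ZMod v // d ≠ 0} := fun x =>
    bif x.2 then ⟨(c x.1.1).diff x.1.2, (c x.1.1).diff_ne_zero hk _⟩
    else ⟨-(c x.1.1).diff x.1.2, neg_ne_zero.2 ((c x.1.1).diff_ne_zero hk _)⟩
  have hsurj : Function.Surjective g := by
    rintro ⟨d, hd⟩
    obtain ⟨a, j, h⟩ := hcover d hd
    rw [← (c a).diff_mod_len j] at h
    rcases h with rfl | rfl
    · exact ⟨⟨⟨a, ⟨j % (c a).len, Nat.mod_lt _ (c a).len_pos⟩⟩, true⟩, rfl⟩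
    · exact ⟨⟨⟨a, ⟨j % (c a).len, Nat.mod_lt _ (c a).len_pos⟩⟩, false⟩, rfl⟩
  have hg : Function.Injective g := by
    refine (hsurj.bijective_of_nat_card_le ?_).1
    rw [Nat.card_eq_fintype_card, Nat.card_eq_fintype_card, Fintype.card_prod, Fintype.card_sigma]
    have : Fintype.card {d : ZMod v // d ≠ 0} = v - 1 := by
      rw [Fintype.card_subtype_compl, Fintype.card_subtype_eq, ZMod.card]
    rw [this]
    simpa [mul_comm] using hcard
  have key : ∀ E ∈ translates c, ∀ x y : ZMod v, s(x, y) ∈ E →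
      ∃ (p : (Σ a, Fin (c a).len) × Bool) (z : ZMod v), (g p : ZMod v) = y - x ∧
        E = translateBlock (c p.1.1).block z ∧
        (bif p.2 then x else y) = (c p.1.1).vtx p.1.2 + z := by
    rintro E ⟨a, z, rfl⟩ x y hxy
    rw [mem_translateBlock, (c a).mem_block hk0] at hxy
    obtain ⟨j, hj⟩ := hxy
    let r : Fin (c a).len := ⟨j % (c a).len, Nat.mod_lt _ (c a).len_pos⟩
    have hE : translateBlock (c a).block z =
        translateBlock (c a).block ((j / (c a).len) • (c a).shift + z) := by
      rw [← translateBlock_add, (c a).translateBlock_block_shift hk0]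
    rw [Sym2.eq_iff] at hj
    have hd : (c a).diff (j % (c a).len) = (c a).vtx (j + 1) - (c a).vtx j := (c a).diff_mod_len j
    rcases hj with ⟨h1, h2⟩ | ⟨h1, h2⟩
    · refine ⟨⟨⟨a, r⟩, true⟩, _, ?_, hE, ?_⟩
      · change (c a).diff (j % (c a).len) = _
        rw [hd, ← h1, ← h2]; ring
      · change x = (c a).vtx (j % (c a).len) + _
        rw [← add_assoc, ← (c a).vtx_eq_mod_len, ← h1]; ring
    · refine ⟨⟨⟨a, r⟩, false⟩, _, ?_, hE, ?_⟩
      · change -(c a).diff (j % (c a).len) = _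
        rw [hd, ← h1, ← h2]; ring
      · change y = (c a).vtx (j % (c a).len) + _
        rw [← add_assoc, ← (c a).vtx_eq_mod_len, ← h2]; ring
  refine ⟨⟨?_, ?_⟩, ?_⟩
  · rintro E ⟨a, z, rfl⟩
    exact isCycleBlock_translateBlock (c a).isCycleBlock_block z
  · intro e he
    induction e with
    | _ x y =>
      rw [Sym2.mk_isDiag_iff] at he
      refine existsUnique_of_exists_of_unique ?_ ?_
      · obtain ⟨a, j, h⟩ := hcover (y - x) (sub_ne_zero.2 (Ne.symm he))
        rcases h with h | h
        · refine ⟨_, ⟨a, x - (c a).vtx j, rfl⟩, ?_⟩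
          rw [mem_translateBlock, (c a).mem_block hk0]
          refine ⟨j, ?_⟩
          rw [BaseCycle.diff] at h
          rw [Sym2.eq_iff]; left
          exact ⟨by ring, by linear_combination h⟩
        · refine ⟨_, ⟨a, y - (c a).vtx j, rfl⟩, ?_⟩
          rw [mem_translateBlock, (c a).mem_block hk0]
          refine ⟨j, ?_⟩
          rw [BaseCycle.diff] at h
          rw [Sym2.eq_iff]; right
          exact ⟨by linear_combination -h, by ring⟩
      · rintro E E' ⟨hE, h⟩ ⟨hE', h'⟩
        obtain ⟨p, z, h1, h2, h3⟩ := key E hE x y h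
        obtain ⟨p', z', h1', h2', h3'⟩ := key E' hE' x y h'
        obtain rfl : p = p' := hg (Subtype.ext (h1.trans h1'.symm))
        rw [h2, h2', add_left_cancel (h3.symm.trans h3')]
  · rintro E ⟨a, z, rfl⟩ w
    exact ⟨a, z + w, translateBlock_add _ _ _⟩

theorem IsCycleBlock.degree_le_two {E : Block v} (hE : IsCycleBlock v k E) {y a b c : ZMod v}
    (ha : s(y, a) ∈ E) (hb : s(y, b) ∈ E) (hc : s(y, c) ∈ E) : a = b ∨ b = c ∨ a = c := by
  obtain ⟨w, hw, rfl⟩ := hE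
  have succ_inj : ∀ i j : Fin k, (i.1 + 1) % k = (j.1 + 1) % k → i = j := by
    intro i j h
    have h' : i.1 ≡ j.1 [MOD k] := Nat.ModEq.add_right_cancel' 1 h
    exact Fin.ext (Nat.ModEq.eq_of_lt_of_lt h' i.2 j.2)
  have key : ∀ x, s(y, x) ∈ edgesOf w →
      (∃ i : Fin k, y = w i ∧ x = w ⟨(i.1 + 1) % k, Nat.mod_lt _ i.pos⟩) ∨
      (∃ i : Fin k, y = w ⟨(i.1 + 1) % k, Nat.mod_lt _ i.pos⟩ ∧ x = w i) := by
    intro x hx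
    simp only [edgesOf, Finset.mem_image, Finset.mem_univ, true_and] at hx
    obtain ⟨i, hi⟩ := hx
    rw [Sym2.eq_iff] at hi
    rcases hi with ⟨h1, h2⟩ | ⟨h1, h2⟩
    · exact Or.inl ⟨i, h1.symm, h2.symm⟩
    · exact Or.inr ⟨i, h2.symm, h1.symm⟩
  have out : ∀ i j : Fin k, y = w i → y = w j → i = j := fun i j hi hj => hw (hi.symm.trans hj)
  have inn : ∀ i j : Fin k, y = w ⟨(i.1 + 1) % k, Nat.mod_lt _ i.pos⟩ →
      y = w ⟨(j.1 + 1) % k, Nat.mod_lt _ j.pos⟩ → i = j := fun i j hi hj =>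
    succ_inj i j (congrArg Fin.val (hw (hi.symm.trans hj)))
  rcases key a ha with ⟨i, h1, h2⟩ | ⟨i, h1, h2⟩ <;>
  rcases key b hb with ⟨j, h3, h4⟩ | ⟨j, h3, h4⟩ <;>
  rcases key c hc with ⟨l, h5, h6⟩ | ⟨l, h5, h6⟩
  · left; rw [h2, h4, out i j h1 h3]
  · left; rw [h2, h4, out i j h1 h3]
  · right; right; rw [h2, h6, out i l h1 h5]
  · right; left; rw [h4, h6, inn j l h3 h5]
  · right; left; rw [h4, h6, out j l h3 h5]
  · right; right; rw [h2, h6, inn i l h1 h5]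
  · left; rw [h2, h4, inn i j h1 h3]
  · left; rw [h2, h4, inn i j h1 h3]

/-- The image of a set of blocks under a permutation of the points. -/
def mapBlocks (f : ZMod v ≃ ZMod v) (B : Set (Block v)) : Set (Block v) :=
  (fun E : Block v => E.image (Sym2.map f)) '' B

theorem mapBlocks_trans (f g : ZMod v ≃ ZMod v) (B : Set (Block v)) :
    mapBlocks (f.trans g) B = mapBlocks g (mapBlocks f B) := by
  simp only [mapBlocks, Set.image_image]
  congr 1
  ext1 E
  rw [Finset.image_image]
  congr 1
  ext e
  induction e with
  | _ a b => simp

theorem mapBlocks_refl (B : Set (Block v)) : mapBlocks (Equiv.refl _) B = B := by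
  simp [mapBlocks]

theorem isomorphic_iff {B B' : Set (Block v)} :
    Isomorphic B B' ↔ ∃ f : ZMod v ≃ ZMod v, B' = mapBlocks f B := Iff.rfl

theorem isomorphic_equivalence :
    Equivalence fun B B' : {B : Set (Block v) // IsCyclicDesign v k B} =>
      Isomorphic B.1 B'.1 := by
  refine ⟨fun B => ⟨Equiv.refl _, (mapBlocks_refl _).symm⟩, ?_, ?_⟩
  · rintro B B' ⟨f, hf⟩
    refine ⟨f.symm, ?_⟩
    change B'.1 = mapBlocks f B.1 at hf
    change _ = mapBlocks _ _
    rw [hf, ← mapBlocks_trans, Equiv.self_trans_symm, mapBlocks_refl]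
  · rintro B B' B'' ⟨f, hf⟩ ⟨g, hg⟩
    refine ⟨f.trans g, ?_⟩
    change B'.1 = mapBlocks f B.1 at hf
    change B''.1 = mapBlocks g B'.1 at hg
    change _ = mapBlocks _ _
    rw [hg, hf, mapBlocks_trans]

theorem mapBlocks_addRight {B : Set (Block v)} (hB : IsCyclicDesign v k B) (z : ZMod v) :
    mapBlocks (Equiv.addRight z) B = B := by
  apply Set.Subset.antisymm
  · rintro _ ⟨E, hE, rfl⟩
    exact hB.2 E hE z
  · intro E hE
    refine ⟨translateBlock E (-z), hB.2 E hE _, ?_⟩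
    change translateBlock (translateBlock E (-z)) z = E
    rw [translateBlock_add]
    simp [translateBlock]

/-- If a permutation preserving the design fixes two consecutive vertices of a block, then it
fixes the next vertex of that block. -/
theorem IsDesign.fixes_next {B : Set (Block v)} (hB : IsDesign v k B) {f : ZMod v ≃ ZMod v}
    (hf : mapBlocks f B = B) {E : Block v} (hE : E ∈ B) {x y z : ZMod v} (hne : x ≠ y)
    (hxy : s(x, y) ∈ E) (hyz : s(y, z) ∈ E) (hx : f x = x) (hy : f y = y) : f z = z := by
  have hmem : E.image (Sym2.map f) ∈ B := by rw [← hf]; exact ⟨E, hE, rfl⟩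
  have himg : E.image (Sym2.map f) = E := by
    refine (hB.2 s(x, y) (by simpa using hne)).unique ⟨hmem, ?_⟩ ⟨hE, hxy⟩
    exact Finset.mem_image.2 ⟨_, hxy, by simp [hx, hy]⟩
  have hfz : s(y, f z) ∈ E := by
    rw [← himg]
    exact Finset.mem_image.2 ⟨_, hyz, by simp [hy]⟩
  rw [Sym2.eq_swap] at hxy
  rcases (hB.1 E hE).degree_le_two hxy hyz hfz with h | h | h
  · rw [← h, hx]
  · exact h.symm
  · rw [h] at hx
    rw [f.injective hx]

theorem IsDesign.fixes_translate {B : Set (Block v)} (hB : IsDesign v k B) (hk : 2 ≤ k)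
    {f : ZMod v ≃ ZMod v} (hf : mapBlocks f B = B) (c : BaseCycle v k)
    (hc : ∀ z, translateBlock c.block z ∈ B) (j : ℕ) (z : ZMod v)
    (h0 : f (c.vtx j + z) = c.vtx j + z) (h1 : f (c.vtx (j + 1) + z) = c.vtx (j + 1) + z)
    (i : ℕ) : f (c.vtx i + z) = c.vtx i + z := by
  have hedge : ∀ j, s(c.vtx j + z, c.vtx (j + 1) + z) ∈ translateBlock c.block z := by
    intro j
    rw [mem_translateBlock, c.mem_block (by omega)]
    exact ⟨j, by simp⟩
  have key : ∀ n, f (c.vtx (j + n) + z) = c.vtx (j + n) + z ∧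
      f (c.vtx (j + n + 1) + z) = c.vtx (j + n + 1) + z := by
    intro n
    induction n with
    | zero => exact ⟨h0, h1⟩
    | succ n ih =>
      refine ⟨ih.2, hB.fixes_next hf (hc z) ?_ (hedge (j + n)) (hedge (j + n + 1)) ih.1 ih.2⟩
      intro h
      exact c.diff_ne_zero hk (j + n) (by rw [BaseCycle.diff, ← add_right_cancel h, sub_self])
  have hi : c.vtx i = c.vtx (j + (i + k * j - j)) := by
    have : j ≤ k * j := Nat.le_mul_of_pos_left j (by omega)
    rw [c.vtx_eq_iff (by omega), show j + (i + k * j - j) = i + k * j by omega]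
    simp
  rw [hi]
  exact (key _).1

theorem card_isomorphic_le [NeZero v] {B : Set (Block v)}
    (x y : ZMod v)
    (hrigid : ∀ f : ZMod v ≃ ZMod v, mapBlocks f B = B → f x = x → f y = y → f = Equiv.refl _) :
    Nat.card {B' : {B : Set (Block v) // IsCyclicDesign v k B} // Isomorphic B B'.1} ≤ v ^ 2 := by
  choose f hf using fun B' : {B' : {B : Set (Block v) // IsCyclicDesign v k B} //
    Isomorphic B B'.1} => isomorphic_iff.1 B'.2
  let g := fun B' => ((f B').trans (Equiv.addRight 1)).trans (f B').symm
  have hg : ∀ B', mapBlocks (g B') B = B := by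
    intro B'
    rw [mapBlocks_trans, mapBlocks_trans, ← hf B', mapBlocks_addRight B'.1.2, hf B',
      ← mapBlocks_trans, Equiv.self_trans_symm, mapBlocks_refl]
  have hgsymm : ∀ B', mapBlocks (g B').symm B = B := by
    intro B'
    conv_lhs => rw [← hg B']
    rw [← mapBlocks_trans, Equiv.self_trans_symm, mapBlocks_refl]
  have hinj : Function.Injective fun B' => (g B' x, g B' y) := by
    intro B₁ B₂ h
    rw [Prod.mk.injEq] at h
    have h12 : (g B₁).trans (g B₂).symm = Equiv.refl _ := by
      apply hrigid
      · rw [mapBlocks_trans, hg, hgsymm]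
      · simp [h.1]
      · simp [h.2]
    have hgg : ∀ w, g B₁ w = g B₂ w := by
      intro w
      have := congrArg (fun e => g B₂ (e w)) h12
      simpa using this
    let t : ZMod v → ZMod v := fun w => f B₂ ((f B₁).symm w)
    have ht : ∀ w, t (w + 1) = t w + 1 := by
      intro w
      have h3 := hgg ((f B₁).symm w)
      simp only [g, Equiv.trans_apply, Equiv.apply_symm_apply, Equiv.coe_addRight] at h3
      simp only [t, h3, Equiv.apply_symm_apply]
    have ht' : ∀ n : ℕ, t n = n + t 0 := by
      intro n
      induction n with
      | zero => simp
      | succ n ih => push_cast; rw [ht, ih]; ring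
    have htr : f B₂ = (f B₁).trans (Equiv.addRight (t 0)) := by
      ext w
      have := ht' ((f B₁ w).val)
      rw [ZMod.natCast_zmod_val] at this
      simpa [t] using this
    apply Subtype.ext
    apply Subtype.ext
    rw [hf B₂, htr, mapBlocks_trans, ← hf B₁, mapBlocks_addRight B₁.1.2]
  have := Nat.card_le_card_of_injective _ hinj
  simpa [sq] using this

/-- A family of pairwise distinct cyclic designs whose automorphisms are determined by the images
of two points yields a lower bound on the number of isomorphism classes. -/
theorem card_le_NC_mul [NeZero v] {Φ : Type*} [Finite Φ] (D : Φ → Set (Block v))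
    (hD : ∀ φ, IsCyclicDesign v k (D φ)) (hinj : Function.Injective D)
    (hrigid : ∀ φ, ∃ x y, ∀ f : ZMod v ≃ ZMod v, mapBlocks f (D φ) = D φ → f x = x → f y = y →
      f = Equiv.refl _) :
    Nat.card Φ ≤ NC v k * v ^ 2 := by
  classical
  cases nonempty_fintype Φ
  let R := fun B B' : {B : Set (Block v) // IsCyclicDesign v k B} => Isomorphic B.1 B'.1
  have : Finite (Quot R) := Finite.of_surjective _ Quot.mk_surjective
  cases nonempty_fintype (Quot R)
  let F : Φ → Quot R := fun φ => Quot.mk R ⟨D φ, hD φ⟩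
  have hfib : ∀ q ∈ Finset.univ.image F, (Finset.univ.filter fun φ => F φ = q).card ≤ v ^ 2 := by
    intro q hq
    obtain ⟨φ₀, -, rfl⟩ := Finset.mem_image.1 hq
    obtain ⟨x, y, hr⟩ := hrigid φ₀
    refine le_trans ?_ (card_isomorphic_le (k := k) x y hr)
    rw [← Fintype.card_subtype, ← Nat.card_eq_fintype_card]
    have hiso : ∀ φ : {φ // F φ = F φ₀}, Isomorphic (D φ₀) (D φ) := by
      intro φ
      have h := Quot.eqvGen_exact φ.2.symm
      rwa [isomorphic_equivalence.eqvGen_iff] at h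
    refine Nat.card_le_card_of_injective
      (fun φ : {φ // F φ = F φ₀} => ⟨⟨D φ, hD φ⟩, hiso φ⟩) ?_
    intro φ φ' h
    simp only [Subtype.mk.injEq] at h
    exact Subtype.ext (hinj h)
  have h := Finset.card_le_mul_card_image Finset.univ (v ^ 2) hfib
  rw [Finset.card_univ, ← Nat.card_eq_fintype_card] at h
  refine h.trans ?_
  rw [mul_comm]
  refine Nat.mul_le_mul_right _ ?_
  rw [NC, Nat.card_eq_fintype_card]
  exact Finset.card_le_univ _

end CyclicDesigns

/-- If two points of `ZMod (k * L)` with given heights over the multiples of `L` agree, then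
the difference of their heights is killed modulo `L`, and at equal height their positions agree
modulo `k`. -/
theorem layer_eq {v k L : ℕ} (hv : v = k * L) (hL : 0 < L) {s s' e e' i : ℤ}
    (h : ((s * L + e * i : ℤ) : ZMod v) = ((s' * L + e' * i : ℤ) : ZMod v)) :
    (L : ℤ) ∣ (e - e') * i ∧ (e = e' → (k : ℤ) ∣ s - s') := by
  have h1 : ((k : ℤ) * L) ∣ (s * L + e * i) - (s' * L + e' * i) := by
    have := (ZMod.intCast_eq_intCast_iff_dvd_sub _ _ _).1 h.symm
    rw [hv] at this
    exact_mod_cast this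
  have hL' : (L : ℤ) ≠ 0 := by exact_mod_cast hL.ne'
  constructor
  · have h2 : (L : ℤ) ∣ (s * L + e * i) - (s' * L + e' * i) := (Dvd.intro_left _ rfl).trans h1
    have h3 : (e - e') * i = ((s * L + e * i) - (s' * L + e' * i)) - (s - s') * L := by ring
    rw [h3]
    exact dvd_sub h2 (Dvd.intro_left _ rfl)
  · rintro rfl
    have h3 : (s * L + e * i) - (s' * L + e * i) = (s - s') * L := by ring
    rw [h3] at h1
    exact Int.dvd_of_mul_dvd_mul_right hL' h1

/-- Multiples of `L` in `ZMod (k * L)` only depend on the factor modulo `k`. -/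
theorem intCast_mul_eq {v k L : ℕ} (hv : v = k * L) {s s' : ℤ} (a : ℤ)
    (h : (k : ℤ) ∣ s - s') : ((s * L + a : ℤ) : ZMod v) = ((s' * L + a : ℤ) : ZMod v) := by
  obtain ⟨q, hq⟩ := h
  symm
  rw [ZMod.intCast_eq_intCast_iff_dvd_sub, hv]
  refine ⟨q, ?_⟩
  push_cast
  linear_combination (L : ℤ) * hq

namespace BaseCycle

variable {v k : ℕ}

/-- The base cycle running once through pairwise distinct vertices `V 0, …, V (k - 1)`. -/
def ofInjOn (hk : 0 < k) (V : ℕ → ZMod v) (hV : Set.InjOn V (Set.Iio k)) : BaseCycle v k where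
  vtx j := V (j % k)
  len := k
  shift := 0
  len_pos := hk
  vtx_add_len j := by simp
  vtx_add_period j := by simp
  inj i hi j hj h := by
    rw [Set.mem_Iio] at hi hj
    simp only [Nat.mod_eq_of_lt hi, Nat.mod_eq_of_lt hj] at h
    exact hV hi hj h

/-- The opposite of a base cycle. -/
def neg (c : BaseCycle v k) : BaseCycle v k where
  vtx j := -c.vtx j
  len := c.len
  shift := -c.shift
  len_pos := c.len_pos
  vtx_add_len j := by rw [c.vtx_add_len, neg_add]
  vtx_add_period j := by rw [c.vtx_add_period]
  inj i hi j hj h := c.inj hi hj (neg_injective h)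

/-- `d` is, up to sign, a difference of an edge of the base cycle `c`. -/
def Covers (c : BaseCycle v k) (d : ZMod v) : Prop := ∃ j, d = c.diff j ∨ d = -c.diff j

theorem Covers.neg_right {c : BaseCycle v k} {d : ZMod v} (h : c.Covers d) : c.Covers (-d) := by
  obtain ⟨j, rfl | rfl⟩ := h
  · exact ⟨j, Or.inr rfl⟩
  · exact ⟨j, Or.inl (neg_neg _)⟩

theorem Covers.neg_left {c : BaseCycle v k} {d : ZMod v} (h : c.Covers d) : c.neg.Covers d := by
  have hd : ∀ j, c.neg.diff j = -c.diff j := fun j => by simp only [diff, neg]; ring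
  obtain ⟨j, rfl | rfl⟩ := h
  · exact ⟨j, Or.inr (by rw [hd, neg_neg])⟩
  · exact ⟨j, Or.inl (by rw [hd])⟩

end BaseCycle

/-- The height of the `m`-th vertex of a column path of length `2 * h`. -/
def colHeight (h m : ℕ) : ℤ := if m = 2 * h then 2 else (m % 2 : ℕ)

/-- The normalized position of the `m`-th vertex of a column path of length `2 * h`. -/
def colPos (h m : ℕ) : ℤ :=
  if m = 2 * h then h + 1
  else if m = 2 * h - 1 then h - 1
  else if m = 2 * h - 2 then h
  else if m % 2 = 0 then (m / 2 : ℕ)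
  else 2 * h - 1 - (m / 2 : ℕ)

theorem colPos_inj {h m m' : ℕ} (hh : 3 ≤ h) (hm : m ≤ 2 * h) (hm' : m' ≤ 2 * h)
    (he : colHeight h m = colHeight h m')
    (hd : ((2 * h + 1 : ℕ) : ℤ) ∣ colPos h m - colPos h m') : m = m' := by
  have hb : ∀ m ≤ 2 * h, 0 ≤ colPos h m ∧ colPos h m ≤ 2 * h := by
    intro m hm
    unfold colPos
    split_ifs <;> omega
  have h0 : colPos h m = colPos h m' := by
    have h1 := hb m hm
    have h2 := hb m' hm'
    have := Int.eq_zero_of_abs_lt_dvd hd (by rw [abs_lt]; push_cast; constructor <;> linarith)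
    linarith
  unfold colPos at h0
  unfold colHeight at he
  split_ifs at he h0 <;> omega

section Column

variable (v h n : ℕ) (i : ℤ)

/-- The `m`-th vertex of the column path in column `i`. -/
def colPath (m : ℕ) : ZMod v :=
  (((colPos h m - (h + 1) * colHeight h m) * (2 * n + 1 : ℕ) + colHeight h m * i : ℤ) : ZMod v)

/-- The end of the column path in column `i`. -/
def colEnd : ZMod v := (((-(h + 1) : ℤ) * (2 * n + 1 : ℕ) + 2 * i : ℤ) : ZMod v)

/-- The `m`-th vertex of the column cycle obtained by inserting the edge of difference
`-colEnd` after the `t`-th step of the column path. -/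
def colVtx (t m : ℕ) : ZMod v :=
  if m ≤ t then colPath v h n i m else colPath v h n i (m - 1) - colEnd v h n i

variable {v h n i}

theorem colPath_zero (hh : 3 ≤ h) : colPath v h n i 0 = 0 := by
  have h1 : colPos h 0 = 0 := by
    unfold colPos
    split_ifs <;> omega
  have h2 : colHeight h 0 = 0 := by
    unfold colHeight
    split_ifs <;> omega
  simp [colPath, h1, h2]

theorem colPath_last : colPath v h n i (2 * h) = colEnd v h n i := by
  unfold colPath colEnd colPos colHeight
  rw [if_pos rfl, if_pos rfl]
  congr 1
  ring

/-- The condition under which an edge can be inserted after the `t`-th step in column `i`. -/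
def ColOK (h n : ℕ) (i : ℤ) (t : ℕ) : Prop :=
  1 ≤ i ∧ i ≤ n ∧ 1 ≤ t ∧ t ≤ 2 * h ∧ (t = 2 * h ∨ 3 * i ≠ 2 * n + 1)

theorem colVtx_injOn (hv : v = (2 * h + 1) * (2 * n + 1)) (hh : 3 ≤ h) {t : ℕ}
    (hi : ColOK h n i t) : Set.InjOn (colVtx v h n i t) (Set.Iio (2 * h + 1)) := by
  obtain ⟨hi1, hin, ht1, ht, h3⟩ := hi
  have key : ∀ m, m < 2 * h + 1 → ∃ s e : ℤ, colVtx v h n i t m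
      = ((s * (2 * n + 1 : ℕ) + e * i : ℤ) : ZMod v) ∧
      ((m ≤ t ∧ e = colHeight h m ∧ s = colPos h m - (h + 1) * e) ∨
        (t < m ∧ e = colHeight h (m - 1) - 2 ∧ s = colPos h (m - 1) - (h + 1) * (e + 1))) := by
    intro m hm
    unfold colVtx
    split_ifs with hmt
    · exact ⟨_, _, rfl, Or.inl ⟨hmt, rfl, rfl⟩⟩
    · refine ⟨_, _, ?_, Or.inr ⟨by omega, rfl, rfl⟩⟩
      unfold colPath colEnd
      rw [← Int.cast_sub]
      congr 1
      ring
  intro m hm m' hm' heq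
  rw [Set.mem_Iio] at hm hm'
  obtain ⟨s, e, h1, h2⟩ := key m hm
  obtain ⟨s', e', h1', h2'⟩ := key m' hm'
  rw [h1, h1'] at heq
  obtain ⟨hdL, hdk⟩ := layer_eq hv (by omega) heq
  have hH : ∀ m, 0 ≤ colHeight h m ∧ colHeight h m ≤ 2 ∧ (m < 2 * h → colHeight h m ≤ 1) := by
    intro m
    unfold colHeight
    split_ifs <;> omega
  have hee : e = e' := by
    have hb : -3 ≤ e - e' ∧ e - e' ≤ 3 ∧ (t = 2 * h → -2 ≤ e - e' ∧ e - e' ≤ 2) := by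
      have := hH m
      have := hH m'
      have := hH (m - 1)
      have := hH (m' - 1)
      rcases h2 with ⟨a1, a2, -⟩ | ⟨a1, a2, -⟩ <;> rcases h2' with ⟨b1, b2, -⟩ | ⟨b1, b2, -⟩ <;>
        omega
    obtain ⟨c, hc⟩ := hdL
    push_cast at hc
    obtain ⟨hb1, hb2, hb3⟩ := hb
    generalize hδ : e - e' = δ at *
    have hn : (0 : ℤ) ≤ n := by positivity
    have hc2 : c < 2 := by by_contra hcon; push Not at hcon; nlinarith
    have hc2' : -2 < c := by by_contra hcon; push Not at hcon; nlinarith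
    have : δ = 0 := by interval_cases δ <;> interval_cases c <;> omega
    omega
  subst hee
  have hdk := hdk rfl
  rcases h2 with ⟨a1, a2, a3⟩ | ⟨a1, a2, a3⟩ <;> rcases h2' with ⟨b1, b2, b3⟩ | ⟨b1, b2, b3⟩
  · apply colPos_inj hh (by omega) (by omega) (by rw [← a2, b2])
    rw [a3, b3] at hdk
    convert hdk using 1
    ring
  · exfalso
    have h4 := hH m
    have h5 := (hH (m' - 1)).2.2 (by omega)
    omega
  · exfalso
    have h4 := hH m'
    have h5 := (hH (m - 1)).2.2 (by omega)
    omega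
  · have : m - 1 = m' - 1 := by
      apply colPos_inj hh (by omega) (by omega) (by omega)
      rw [a3, b3] at hdk
      convert hdk using 1
      ring
    omega

/-- The column cycle in column `i` with an edge inserted after step `t`. -/
def colCycle (hv : v = (2 * h + 1) * (2 * n + 1)) (hh : 3 ≤ h) {t : ℕ}
    (hi : ColOK h n i t) : BaseCycle v (2 * h + 1) :=
  BaseCycle.ofInjOn (by omega) (colVtx v h n i t) (colVtx_injOn hv hh hi)

/-- The difference of the `m`-th step of the column path. -/
def colStep (v h n : ℕ) (i : ℤ) (m : ℕ) : ZMod v := colPath v h n i (m + 1) - colPath v h n i m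

section

variable (hv : v = (2 * h + 1) * (2 * n + 1)) (hh : 3 ≤ h) {t : ℕ} (hi : ColOK h n i t)

theorem colCycle_vtx_le {m : ℕ} (hm : m ≤ t) :
    (colCycle hv hh hi).vtx m = colPath v h n i m := by
  have := hi.2.2.2.1
  simp only [colCycle, BaseCycle.ofInjOn]
  rw [Nat.mod_eq_of_lt (by omega), colVtx, if_pos hm]

theorem colCycle_vtx_gt {m : ℕ} (hm : t < m) (hm' : m ≤ 2 * h + 1) :
    (colCycle hv hh hi).vtx m = colPath v h n i (m - 1) - colEnd v h n i := by
  simp only [colCycle, BaseCycle.ofInjOn]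
  rcases Nat.lt_or_ge m (2 * h + 1) with h1 | h1
  · rw [Nat.mod_eq_of_lt h1, colVtx, if_neg (by omega)]
  · obtain rfl : m = 2 * h + 1 := by omega
    rw [Nat.mod_self, colVtx, if_pos (by omega), colPath_zero hh, Nat.add_sub_cancel,
      colPath_last, sub_self]

theorem colCycle_covers_colStep {m : ℕ} (hm : m < 2 * h) :
    (colCycle hv hh hi).Covers (colStep v h n i m) := by
  rcases Nat.lt_or_ge m t with h1 | h1
  · refine ⟨m, Or.inl ?_⟩
    rw [BaseCycle.diff, colCycle_vtx_le hv hh hi (show m + 1 ≤ t by omega),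
      colCycle_vtx_le hv hh hi (show m ≤ t by omega)]
    rfl
  · refine ⟨m + 1, Or.inl ?_⟩
    rw [BaseCycle.diff, colCycle_vtx_gt hv hh hi (show t < m + 1 + 1 by omega) (by omega),
      colCycle_vtx_gt hv hh hi (show t < m + 1 by omega) (by omega)]
    simp [colStep]

theorem colCycle_covers_colEnd : (colCycle hv hh hi).Covers (colEnd v h n i) := by
  have := hi.2.2.2.1
  refine ⟨t, Or.inr ?_⟩
  rw [BaseCycle.diff, colCycle_vtx_le hv hh hi le_rfl,
    colCycle_vtx_gt hv hh hi (show t < t + 1 by omega) (by omega)]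
  simp

end

/-- The factor of the `m`-th step of a column path. -/
def colFactor (h m : ℕ) : ℤ :=
  if m = 2 * h - 1 then 2 else if m = 2 * h - 2 then -1 else if m = 2 * h - 3 then 1
  else 2 * h - 1 - m

theorem colStep_eq (hh : 3 ≤ h) {m : ℕ} (hm : m < 2 * h) :
    colStep v h n i m =
      if m % 2 = 0 ∨ m = 2 * h - 1 then
        (((colFactor h m - (h + 1)) * (2 * n + 1 : ℕ) + i : ℤ) : ZMod v)
      else -(((colFactor h m - (h + 1)) * (2 * n + 1 : ℕ) + i : ℤ) : ZMod v) := by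
  have key : ∀ σ : ℤ, colHeight h (m + 1) - colHeight h m = σ →
      colPos h (m + 1) - colPos h m = σ * colFactor h m →
      colStep v h n i m =
        ((σ * ((colFactor h m - (h + 1)) * (2 * n + 1 : ℕ) + i) : ℤ) : ZMod v) := by
    intro σ h1 h2
    unfold colStep colPath
    rw [← Int.cast_sub]
    congr 1
    linear_combination ((2 * n + 1 : ℕ) : ℤ) * h2 + (i - (h + 1) * ((2 * n + 1 : ℕ) : ℤ)) * h1
  split_ifs with hc
  · rw [key 1, one_mul]
    · unfold colHeight
      split_ifs <;> omega
    · unfold colPos colFactor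
      split_ifs <;> omega
  · rw [key (-1), neg_one_mul, Int.cast_neg]
    · unfold colHeight
      split_ifs <;> omega
    · unfold colPos colFactor
      split_ifs <;> omega

theorem exists_colFactor (hh : 3 ≤ h) {x : ℤ} (hx : ¬ ((2 * h + 1 : ℕ) : ℤ) ∣ x) :
    ∃ m < 2 * h, ((2 * h + 1 : ℕ) : ℤ) ∣ x - colFactor h m := by
  have hk : ((2 * h + 1 : ℕ) : ℤ) ≠ 0 := by positivity
  have h0 := Int.emod_nonneg x hk
  have h1 := Int.emod_lt_of_pos x (show (0 : ℤ) < (2 * h + 1 : ℕ) by positivity)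
  have h2 : ((2 * h + 1 : ℕ) : ℤ) ∣ x - x % ((2 * h + 1 : ℕ) : ℤ) := Int.dvd_self_sub_emod
  have h3 : x % ((2 * h + 1 : ℕ) : ℤ) ≠ 0 := fun h => hx (Int.dvd_of_emod_eq_zero h)
  generalize x % ((2 * h + 1 : ℕ) : ℤ) = y at *
  have hm : ∀ y : ℤ, (∃ m < 2 * h, y = colFactor h m) → ((2 * h + 1 : ℕ) : ℤ) ∣ x - y →
      ∃ m < 2 * h, ((2 * h + 1 : ℕ) : ℤ) ∣ x - colFactor h m := by
    rintro _ ⟨m, hm, rfl⟩ hd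
    exact ⟨m, hm, hd⟩
  by_cases hy : y = 2 * h
  · apply hm (-1) ⟨2 * h - 2, by omega, by unfold colFactor; split_ifs <;> omega⟩
    have h4 : x - -1 = x - y + ((2 * h + 1 : ℕ) : ℤ) := by
      rw [hy]
      push_cast
      ring
    rw [h4]
    exact h2.add (dvd_refl _)
  · refine hm y ?_ h2
    push_cast at h1
    rcases eq_or_ne y 1 with rfl | hy1
    · exact ⟨2 * h - 3, by omega, by unfold colFactor; split_ifs <;> omega⟩
    rcases eq_or_ne y 2 with rfl | hy2
    · exact ⟨2 * h - 1, by omega, by unfold colFactor; split_ifs <;> omega⟩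
    exact ⟨(2 * h - 1 - y).toNat, by omega, by unfold colFactor; split_ifs <;> omega⟩

/-- A column cycle covers all elements of its column but one. -/
theorem colCycle_covers (hv : v = (2 * h + 1) * (2 * n + 1)) (hh : 3 ≤ h) {t : ℕ}
    (hi : ColOK h n i t) {x : ℤ} (hx : ¬ ((2 * h + 1 : ℕ) : ℤ) ∣ x) :
    (colCycle hv hh hi).Covers (((x - (h + 1)) * (2 * n + 1 : ℕ) + i : ℤ) : ZMod v) := by
  obtain ⟨m, hm, hd⟩ := exists_colFactor hh hx
  rw [intCast_mul_eq hv i (s' := colFactor h m - (h + 1)) (by simpa using hd)]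
  have h1 := colStep_eq (v := v) (n := n) (i := i) hh hm
  have h2 := colCycle_covers_colStep hv hh hi hm
  split_ifs at h1 with hc
  · rwa [← h1]
  · have := h2.neg_right
    rwa [h1, neg_neg] at this

end Column

section ColumnRigidity

variable {v h n : ℕ} {i : ℤ}

theorem colStep_repr (hh : 3 ≤ h) {m : ℕ} (hm : m < 2 * h) :
    ∃ σ : ℤ, (σ = 1 ∨ σ = -1) ∧ colStep v h n i m =
      ((σ * (colFactor h m - (h + 1)) * (2 * n + 1 : ℕ) + σ * i : ℤ) : ZMod v) := by
  rw [colStep_eq hh hm]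
  split_ifs
  · exact ⟨1, Or.inl rfl, by congr 1; ring⟩
  · exact ⟨-1, Or.inr rfl, by rw [← Int.cast_neg]; congr 1; ring⟩

theorem colFactor_inj (hh : 3 ≤ h) {m m' : ℕ} (hm : m < 2 * h) (hm' : m' < 2 * h)
    (hd : ((2 * h + 1 : ℕ) : ℤ) ∣ colFactor h m - colFactor h m') : m = m' := by
  have hb : ∀ m < 2 * h, -1 ≤ colFactor h m ∧ colFactor h m < 2 * h := by
    intro m hm
    unfold colFactor
    split_ifs <;> omega
  have h0 : colFactor h m = colFactor h m' := by
    have h1 := hb m hm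
    have h2 := hb m' hm'
    have := Int.eq_zero_of_abs_lt_dvd hd (by rw [abs_lt]; push_cast; constructor <;> linarith)
    linarith
  unfold colFactor at h0
  split_ifs at h0 <;> omega

theorem not_dvd_mul_column {c : ℤ} (hi : 1 ≤ i) (hin : i ≤ n) (hc0 : c ≠ 0) (hc : |c| ≤ 2) :
    ¬ ((2 * n + 1 : ℕ) : ℤ) ∣ c * i := by
  intro hd
  rw [abs_le] at hc
  obtain ⟨hc1, hc2⟩ := hc
  have := Int.eq_zero_of_abs_lt_dvd hd (by rw [abs_lt]; push_cast; constructor <;> nlinarith)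
  rcases mul_eq_zero.1 this with h1 | h1 <;> omega

theorem colStep_inj (hv : v = (2 * h + 1) * (2 * n + 1)) (hh : 3 ≤ h) (hi : 1 ≤ i) (hin : i ≤ n)
    {m m' : ℕ} (hm : m < 2 * h) (hm' : m' < 2 * h)
    (heq : colStep v h n i m = colStep v h n i m') : m = m' := by
  obtain ⟨σ, hσ, h1⟩ := colStep_repr (v := v) (n := n) (i := i) hh hm
  obtain ⟨σ', hσ', h1'⟩ := colStep_repr (v := v) (n := n) (i := i) hh hm'
  rw [h1, h1'] at heq
  obtain ⟨h2, h3⟩ := layer_eq hv (by omega) heq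
  have hee : σ = σ' := by
    by_contra hne
    refine not_dvd_mul_column hi hin (sub_ne_zero.2 hne) ?_ h2
    rcases hσ with rfl | rfl <;> rcases hσ' with rfl | rfl <;> norm_num
  subst hee
  apply colFactor_inj hh hm hm'
  have h4 := h3 rfl
  rcases hσ with rfl | rfl
  · convert h4 using 1
    ring
  · rw [← dvd_neg]
    rw [show -(colFactor h m - colFactor h m') = -1 * (colFactor h m - (h + 1)) -
      -1 * (colFactor h m' - (h + 1)) by ring]
    exact h4

theorem colStep_ne_colEnd (hv : v = (2 * h + 1) * (2 * n + 1)) (hh : 3 ≤ h) (hi : 1 ≤ i)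
    (hin : i ≤ n) (h3 : 3 * i ≠ 2 * n + 1) {m : ℕ} (hm : m < 2 * h) :
    colStep v h n i m ≠ colEnd v h n i := by
  intro heq
  obtain ⟨σ, hσ, h1⟩ := colStep_repr (v := v) (n := n) (i := i) hh hm
  rw [h1] at heq
  have h2 := (layer_eq hv (by omega) heq).1
  rcases hσ with rfl | rfl
  · exact not_dvd_mul_column hi hin (by norm_num) (by norm_num) h2
  · obtain ⟨c, hc⟩ := h2
    push_cast at hc
    have hn : (0 : ℤ) ≤ n := by positivity
    have hc2 : c < 0 := by by_contra hcon; push Not at hcon; nlinarith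
    have hc2' : -2 < c := by by_contra hcon; push Not at hcon; nlinarith
    interval_cases c
    omega

/-- A base cycle, reversed in sign if `b` is true. -/
def BaseCycle.signed {k : ℕ} (b : Bool) (c : BaseCycle v k) : BaseCycle v k :=
  bif b then c.neg else c

theorem BaseCycle.Covers.signed {k : ℕ} {c : BaseCycle v k} {d : ZMod v} (hc : c.Covers d)
    (b : Bool) : (c.signed b).Covers d := by
  cases b
  · exact hc
  · exact hc.neg_left

theorem BaseCycle.signed_len {k : ℕ} (c : BaseCycle v k) (b : Bool) :
    (c.signed b).len = c.len := by
  cases b <;> rfl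

/-- The step of the column path that follows the edge inserted after the `t`-th step. -/
def nextStep (h t : ℕ) : ℕ := if t = 2 * h then 0 else t

/-- The edge inserted after the `t`-th step of a column path, together with its two neighbours. -/
theorem colCycle_local (hv : v = (2 * h + 1) * (2 * n + 1)) (hh : 3 ≤ h) {t : ℕ}
    (hi : ColOK h n i t) :
    s(colPath v h n i t, colPath v h n i t - colEnd v h n i) ∈ (colCycle hv hh hi).block ∧
    s(colPath v h n i t, colPath v h n i t - colStep v h n i (t - 1)) ∈
      (colCycle hv hh hi).block ∧
    s(colPath v h n i t - colEnd v h n i,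
      colPath v h n i t - colEnd v h n i + colStep v h n i (nextStep h t)) ∈
      (colCycle hv hh hi).block := by
  obtain ⟨-, -, ht1, ht, -⟩ := id hi
  refine ⟨?_, ?_, ?_⟩ <;> rw [BaseCycle.mem_block _ (by omega)]
  · refine ⟨t, ?_⟩
    rw [colCycle_vtx_le hv hh hi le_rfl, colCycle_vtx_gt hv hh hi (by omega) (by omega),
      Nat.add_sub_cancel]
  · refine ⟨t - 1, ?_⟩
    rw [colCycle_vtx_le hv hh hi (show t - 1 ≤ t by omega), Nat.sub_add_cancel ht1,
      colCycle_vtx_le hv hh hi le_rfl, colStep, Nat.sub_add_cancel ht1, sub_sub_cancel,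
      Sym2.eq_swap]
  · unfold nextStep
    split_ifs with h1
    · refine ⟨0, ?_⟩
      rw [colCycle_vtx_le hv hh hi (show 0 ≤ t by omega),
        colCycle_vtx_le hv hh hi (show 0 + 1 ≤ t by omega), colStep, h1, colPath_last, sub_self,
        zero_add, colPath_zero hh, sub_zero]
    · refine ⟨t + 1, ?_⟩
      rw [colCycle_vtx_gt hv hh hi (show t < t + 1 by omega) (by omega),
        colCycle_vtx_gt hv hh hi (show t < t + 1 + 1 by omega) (by omega), colStep,
        Nat.add_sub_cancel, Nat.add_sub_cancel]
      congr 2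
      ring

theorem neg_mem_neg_block {k : ℕ} (hk : 0 < k) {c : BaseCycle v k} {a b : ZMod v}
    (hab : s(a, b) ∈ c.block) : s(-a, -b) ∈ c.neg.block := by
  rw [BaseCycle.mem_block _ hk] at hab ⊢
  obtain ⟨j, hj⟩ := hab
  refine ⟨j, ?_⟩
  simpa [BaseCycle.neg] using congrArg (Sym2.map Neg.neg) hj

theorem signed_colCycle_local (hv : v = (2 * h + 1) * (2 * n + 1)) (hh : 3 ≤ h) {t : ℕ}
    (hi : ColOK h n i t) (b : Bool) :
    ∃ z, s(0, -colEnd v h n i) ∈ translateBlock ((colCycle hv hh hi).signed b).block z ∧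
      s(0, -colStep v h n i (bif b then nextStep h t else t - 1)) ∈
        translateBlock ((colCycle hv hh hi).signed b).block z ∧
      s(-colEnd v h n i,
        -colEnd v h n i + colStep v h n i (bif b then t - 1 else nextStep h t)) ∈
        translateBlock ((colCycle hv hh hi).signed b).block z := by
  obtain ⟨h1, h2, h3⟩ := colCycle_local hv hh hi
  simp only [mem_translateBlock]
  have hcongr : ∀ {E : Block v} {x y x' y' : ZMod v}, s(x, y) ∈ E → x' = x → y' = y →
      s(x', y') ∈ E := by
    rintro E x y _ _ h rfl rfl
    exact h
  cases b
  · exact ⟨-colPath v h n i t, hcongr h1 (by ring) (by ring),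
      hcongr h2 (by ring) (by rw [cond_false]; ring),
      hcongr h3 (by ring) (by rw [cond_false]; ring)⟩
  · have hk : 0 < 2 * h + 1 := by omega
    have h1' := h1
    rw [Sym2.eq_swap] at h1'
    exact ⟨colPath v h n i t - colEnd v h n i,
      hcongr (neg_mem_neg_block hk h1') (by ring) (by ring),
      hcongr (neg_mem_neg_block hk h3) (by ring) (by rw [cond_true]; ring),
      hcongr (neg_mem_neg_block hk h2) (by ring) (by rw [cond_true]; ring)⟩

/-- The insertion place and the sign of a column cycle are determined by the neighbours of the
inserted edge. -/
theorem colCycle_params_eq (hv : v = (2 * h + 1) * (2 * n + 1)) (hh : 3 ≤ h) (hi : 1 ≤ i)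
    (hin : i ≤ n) (h3 : 3 * i ≠ 2 * n + 1) {B : Set (Block v)} (hB : IsDesign v (2 * h + 1) B)
    {t t' : ℕ} (ht : ColOK h n i t) (ht' : ColOK h n i t') {b b' : Bool}
    (hc : ∀ z, translateBlock ((colCycle hv hh ht).signed b).block z ∈ B)
    (hc' : ∀ z, translateBlock ((colCycle hv hh ht').signed b').block z ∈ B) :
    t = t' ∧ b = b' := by
  obtain ⟨z, h1, h2, h4⟩ := signed_colCycle_local hv hh ht b
  obtain ⟨z', h1', h2', h4'⟩ := signed_colCycle_local hv hh ht' b'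
  have hD : colEnd v h n i ≠ 0 := by
    intro h0
    refine not_dvd_mul_column (c := 2 - 0) hi hin (by norm_num) (by norm_num)
      (layer_eq (v := v) (s := -(h + 1)) (s' := 0) (e' := 0) hv (by omega) ?_).1
    rw [← colEnd, h0]
    simp
  have hE := (hB.2 s(0, -colEnd v h n i) (by simpa [Sym2.mk_isDiag_iff] using hD)).unique
    ⟨hc z, h1⟩ ⟨hc' z', h1'⟩
  rw [← hE] at h2' h4'
  have hcyc := hB.1 _ (hc z)
  have hnext : ∀ {t}, ColOK h n i t → nextStep h t < 2 * h := by
    intro t ht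
    have := ht.2.2.2.1
    unfold nextStep
    split_ifs <;> omega
  have hlt : ∀ {t}, ColOK h n i t → t - 1 < 2 * h := by
    intro t ht
    have := ht.2.2.2.1
    omega
  have hltb : ∀ {t} (b : Bool), ColOK h n i t →
      (bif b then nextStep h t else t - 1) < 2 * h := by
    rintro t (_ | _) ht
    exacts [hlt ht, hnext ht]
  have hltb' : ∀ {t} (b : Bool), ColOK h n i t →
      (bif b then t - 1 else nextStep h t) < 2 * h := by
    rintro t (_ | _) ht
    exacts [hnext ht, hlt ht]
  have hx : (bif b then nextStep h t else t - 1) = (bif b' then nextStep h t' else t' - 1) := by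
    apply colStep_inj hv hh hi hin (hltb b ht) (hltb b' ht')
    rcases hcyc.degree_le_two h1 h2 h2' with h5 | h5 | h5
    · exact absurd (neg_injective h5).symm (colStep_ne_colEnd hv hh hi hin h3 (hltb b ht))
    · exact neg_injective h5
    · exact absurd (neg_injective h5).symm (colStep_ne_colEnd hv hh hi hin h3 (hltb b' ht'))
  have hy : (bif b then t - 1 else nextStep h t) = (bif b' then t' - 1 else nextStep h t') := by
    apply colStep_inj hv hh hi hin (hltb' b ht) (hltb' b' ht')
    rw [Sym2.eq_swap] at h1
    rcases hcyc.degree_le_two h1 h4 h4' with h5 | h5 | h5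
    · exact absurd (neg_add_eq_zero.1 h5.symm).symm
        (colStep_ne_colEnd hv hh hi hin h3 (hltb' b ht))
    · exact add_left_cancel h5
    · exact absurd (neg_add_eq_zero.1 h5.symm).symm
        (colStep_ne_colEnd hv hh hi hin h3 (hltb' b' ht'))
  obtain ⟨-, -, a1, a2, -⟩ := ht
  obtain ⟨-, -, a1', a2', -⟩ := ht'
  unfold nextStep at hx hy
  cases b <;> cases b' <;> simp only [cond_true, cond_false] at hx hy <;> split_ifs at hx hy <;>
    simp <;> omega

/-- An automorphism of a design containing the unmodified cycle of column one is determined by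
two suitable values. -/
theorem eq_refl_of_fixes_colCycle (hv : v = (2 * h + 1) * (2 * n + 1)) (hh : 3 ≤ h)
    {B : Set (Block v)} (hB : IsDesign v (2 * h + 1) B) (h1 : ColOK h n 1 (2 * h))
    (hc : ∀ z, translateBlock (colCycle hv hh h1).block z ∈ B) {f : ZMod v ≃ ZMod v}
    (hf : mapBlocks f B = B) (hx : f (colPath v h n 1 (2 * h - 3)) = colPath v h n 1 (2 * h - 3))
    (hy : f (colPath v h n 1 (2 * h - 2)) = colPath v h n 1 (2 * h - 2)) :
    f = Equiv.refl _ := by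
  set P := colPath v h n 1 with hP
  have hvtx : ∀ m ≤ 2 * h, (colCycle hv hh h1).vtx m = P m := fun m hm =>
    colCycle_vtx_le hv hh h1 hm
  set Z : Set (ZMod v) := {z | ∀ m ≤ 2 * h, f (P m + z) = P m + z} with hZ
  have hmem : ∀ m < 2 * h, ∀ z, f (P m + z) = P m + z → f (P (m + 1) + z) = P (m + 1) + z →
      z ∈ Z := by
    intro m hm z h2 h3 m' hm'
    rw [← hvtx m' hm']
    refine hB.fixes_translate (by omega) hf _ hc m z ?_ ?_ m'
    · rwa [hvtx m (by omega)]
    · rwa [hvtx (m + 1) (by omega)]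
  have h0 : (0 : ZMod v) ∈ Z := by
    apply hmem (2 * h - 3) (by omega)
    · rwa [add_zero]
    · rwa [show 2 * h - 3 + 1 = 2 * h - 2 by omega, add_zero]
  have hdiff : ∀ {m m' : ℕ} {a b : ℤ}, colHeight h m' + b = colHeight h m →
      colPos h m - (h + 1) * colHeight h m = colPos h m' - (h + 1) * colHeight h m' + a →
      P m = P m' + ((a * (2 * n + 1 : ℕ) + b : ℤ) : ZMod v) := by
    intro m m' a b e1 e2
    rw [hP]
    unfold colPath
    rw [← Int.cast_add]
    congr 1
    rw [e2, ← e1]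
    ring
  have hstep : ∀ z ∈ Z, z + ((-2 * (2 * n + 1 : ℕ) + 0 : ℤ) : ZMod v) ∈ Z := by
    intro z hz
    apply hmem (2 * h - 3) (by omega)
    · have h2 : P (2 * h - 1) = P (2 * h - 3) + ((-2 * (2 * n + 1 : ℕ) + 0 : ℤ) : ZMod v) := by
        apply hdiff
        · unfold colHeight
          split_ifs <;> omega
        · have e1 : colHeight h (2 * h - 1) = colHeight h (2 * h - 3) := by
            unfold colHeight
            split_ifs <;> omega
          rw [e1]
          have e2 : colPos h (2 * h - 1) = colPos h (2 * h - 3) - 2 := by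
            unfold colPos
            split_ifs <;> omega
          rw [e2]
          ring
      have h3 := hz (2 * h - 1) (by omega)
      rwa [h2, add_assoc, add_comm _ z] at h3
    · have h2 : P (2 * h - 4) = P (2 * h - 2) + ((-2 * (2 * n + 1 : ℕ) + 0 : ℤ) : ZMod v) := by
        apply hdiff
        · unfold colHeight
          split_ifs <;> omega
        · have e1 : colHeight h (2 * h - 4) = colHeight h (2 * h - 2) := by
            unfold colHeight
            split_ifs <;> omega
          rw [e1]
          have e2 : colPos h (2 * h - 4) = colPos h (2 * h - 2) - 2 := by
            unfold colPos
            split_ifs <;> omega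
          rw [e2]
          ring
      have h3 := hz (2 * h - 4) (by omega)
      rw [show 2 * h - 3 + 1 = 2 * h - 2 by omega]
      rwa [h2, add_assoc, add_comm _ z] at h3
  have hsteps : ∀ q : ℕ, ∀ z ∈ Z, z + ((-2 * q * (2 * n + 1 : ℕ) + 0 : ℤ) : ZMod v) ∈ Z := by
    intro q
    induction q with
    | zero => intro z hz; simpa using hz
    | succ q ih =>
      intro z hz
      convert hstep _ (ih z hz) using 1
      push_cast
      ring
  have hL : ∀ a : ℤ, ∀ z ∈ Z, z + ((a * (2 * n + 1 : ℕ) + 0 : ℤ) : ZMod v) ∈ Z := by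
    intro a z hz
    have hk : ((2 * h + 1 : ℕ) : ℤ) ≠ 0 := by positivity
    have h2 := Int.emod_nonneg (a * h) hk
    have h3 := hsteps (a * h % ((2 * h + 1 : ℕ) : ℤ)).toNat z hz
    rw [Int.toNat_of_nonneg h2] at h3
    rwa [intCast_mul_eq hv (s' := a) 0] at h3
    have h4 : ((2 * h + 1 : ℕ) : ℤ) ∣ a * h - a * h % ((2 * h + 1 : ℕ) : ℤ) :=
      Int.dvd_self_sub_emod
    generalize a * h % ((2 * h + 1 : ℕ) : ℤ) = y at h4
    obtain ⟨c, hc⟩ := h4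
    refine ⟨2 * c - a, ?_⟩
    push_cast at hc ⊢
    linear_combination 2 * hc
  have hone : ∀ z ∈ Z, z + 1 ∈ Z := by
    intro z hz
    have hm0 : colHeight h 0 = 0 := by
      unfold colHeight
      split_ifs <;> omega
    have hm1 : colHeight h 1 = 1 := by
      unfold colHeight
      split_ifs <;> omega
    have hm2 : colHeight h (2 * h) = 2 := by
      rw [colHeight, if_pos rfl]
    have hup : ∀ {m m' : ℕ}, m' ≤ 2 * h → colHeight h m' = colHeight h m + 1 →
        f (P m + (z + 1)) = P m + (z + 1) := by
      intro m m' hm' he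
      obtain ⟨a, ha⟩ : ∃ a, a = colPos h m' - (h + 1) * colHeight h m' -
          (colPos h m - (h + 1) * colHeight h m) := ⟨_, rfl⟩
      have h2 : P m' = P m + ((a * (2 * n + 1 : ℕ) + 1 : ℤ) : ZMod v) :=
        hdiff he.symm (by rw [ha]; ring)
      have h3 := hL (-a) z hz m' hm'
      have h4 : P m' + (z + ((-a * (2 * n + 1 : ℕ) + 0 : ℤ) : ZMod v)) = P m + (z + 1) := by
        rw [h2]
        push_cast
        ring
      rwa [h4] at h3
    exact hmem 0 (by omega) _ (hup (m' := 1) (by omega) (by omega))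
      (hup (m' := 2 * h) le_rfl (by rw [zero_add]; omega))
  have hnat : ∀ q : ℕ, (q : ZMod v) ∈ Z := by
    intro q
    induction q with
    | zero => simpa using h0
    | succ q ih => simpa using hone _ ih
  have : NeZero v := ⟨by rw [hv]; positivity⟩
  ext x
  have h2 := hnat x.val 0 (by omega)
  rw [hP, colPath_zero hh, zero_add, ZMod.natCast_zmod_val] at h2
  rw [h2, Equiv.refl_apply]

end ColumnRigidity

section AuxiliaryCycles

/-- The cycle of multiples of `x * L` in `ZMod (k * L)`. -/
def multCycle {v k L : ℕ} (hv : v = k * L) (hL : 0 < L) {x : ℤ} (hx : IsCoprime (k : ℤ) x) :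
    BaseCycle v k where
  vtx j := ((j * x * L + 0 * 0 : ℤ) : ZMod v)
  len := 1
  shift := ((x * L : ℤ) : ZMod v)
  len_pos := one_pos
  vtx_add_len j := by
    push_cast
    ring
  vtx_add_period j := intCast_mul_eq hv _ ⟨x, by push_cast; ring⟩
  inj i hi j hj h := by
    rw [Set.mem_Iio] at hi hj
    have h1 := (layer_eq hv hL h).2 rfl
    rw [← sub_mul] at h1
    have h2 := hx.dvd_of_dvd_mul_right h1
    have := Int.eq_zero_of_abs_lt_dvd h2 (by rw [abs_lt]; constructor <;> omega)
    omega

theorem multCycle_covers {v k L : ℕ} (hv : v = k * L) (hL : 0 < L) {x : ℤ}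
    (hx : IsCoprime (k : ℤ) x) : (multCycle hv hL hx).Covers ((x * L : ℤ) : ZMod v) := by
  refine ⟨0, Or.inl ?_⟩
  simp [BaseCycle.diff, multCycle]

/-- The arithmetic data behind the auxiliary cycles for a composite cycle length
`k = (2 * a + 1) * (2 * μ + 1)`: here `g` is an inverse of `2 * a + 2` modulo `k`. -/
structure CompositeData (v k n a μ : ℕ) (g : ℤ) : Prop where
  hv : v = k * (2 * n + 1)
  hk : k = (2 * a + 1) * (2 * μ + 1)
  ha : 1 ≤ a
  hμ : 1 ≤ μ
  hn : 2 ≤ n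
  hg : (k : ℤ) ∣ (2 * a + 2) * g - 1
  hcop : ∀ x : ℕ, 1 ≤ x → x ≤ a → IsCoprime (k : ℤ) (x : ℤ)

/-- The point at position `s` and height `e` with respect to the generator `g * (2 * n + 1)` of
the multiples of `2 * n + 1`. -/
def pt (v n : ℕ) (g s e : ℤ) : ZMod v := ((s * g * (2 * n + 1 : ℕ) + e * 2 : ℤ) : ZMod v)

variable {v k n a μ : ℕ} {g : ℤ}

theorem pt_add (s s' e e' : ℤ) : pt v n g s e + pt v n g s' e' = pt v n g (s + s') (e + e') := by
  unfold pt
  rw [← Int.cast_add]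
  congr 1
  ring

theorem pt_sub (s s' e e' : ℤ) : pt v n g s e - pt v n g s' e' = pt v n g (s - s') (e - e') := by
  unfold pt
  rw [← Int.cast_sub]
  congr 1
  ring

theorem neg_pt (s e : ℤ) : -pt v n g s e = pt v n g (-s) (-e) := by
  unfold pt
  rw [← Int.cast_neg]
  congr 1
  ring

namespace CompositeData

theorem k_pos (A : CompositeData v k n a μ g) : 0 < k := by
  rw [A.hk]
  positivity

theorem pt_congr (A : CompositeData v k n a μ g) {s s' : ℤ} (e : ℤ) (h : (k : ℤ) ∣ s - s') :
    pt v n g s e = pt v n g s' e := by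
  refine intCast_mul_eq A.hv _ ?_
  rw [← sub_mul]
  exact h.mul_right g

theorem isCoprime_inv (A : CompositeData v k n a μ g) : IsCoprime (k : ℤ) g := by
  obtain ⟨c, hc⟩ := A.hg
  exact ⟨-c, 2 * a + 2, by linear_combination hc⟩

theorem pt_inj (A : CompositeData v k n a μ g) {s s' e e' : ℤ} (he : |e - e'| ≤ 2)
    (h : pt v n g s e = pt v n g s' e') : e = e' ∧ (k : ℤ) ∣ s - s' := by
  obtain ⟨h1, h2⟩ := layer_eq A.hv (by omega) h
  have hn : (2 : ℤ) ≤ n := by exact_mod_cast A.hn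
  have hee : e = e' := by
    by_contra hne
    exact not_dvd_mul_column (by norm_num) hn (sub_ne_zero.2 hne) he h1
  refine ⟨hee, ?_⟩
  have h3 := h2 hee
  rw [← sub_mul] at h3
  exact A.isCoprime_inv.dvd_of_dvd_mul_right h3

/-- The position of the `r`-th vertex of a short cycle. -/
def shortPos (a f r : ℕ) : ℤ :=
  if r = 2 * a then a + 2 * ((2 * a + 1) * f)
  else if r % 2 = 0 then (r / 2 : ℕ) else a - 2 - (r / 2 : ℕ) + (2 * a + 1) * f

theorem shortPos_inj {a f r r' : ℕ} (hr : r ≤ 2 * a) (hr' : r' ≤ 2 * a)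
    (hp : r % 2 = r' % 2) (hd : (2 * a + 1 : ℤ) ∣ shortPos a f r - shortPos a f r') : r = r' := by
  have key : ∀ r ≤ 2 * a, ∃ c : ℤ, shortPos a f r =
      (if r % 2 = 0 then ((r / 2 : ℕ) : ℤ) else a - 2 - (r / 2 : ℕ)) + (2 * a + 1) * c := by
    intro r hr
    unfold shortPos
    split_ifs with h1 h2
    · exact ⟨2 * f, by rw [h1]; push_cast; rw [show (2 * a : ℤ) / 2 = a by omega]; ring⟩
    · omega
    · exact ⟨0, by ring⟩
    · exact ⟨f, by ring⟩
  obtain ⟨c, hc⟩ := key r hr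
  obtain ⟨c', hc'⟩ := key r' hr'
  rw [hc, hc', add_sub_add_comm, ← mul_sub] at hd
  have h1 := (Int.dvd_add_left (Dvd.intro _ rfl)).1 hd
  have h2 := Int.eq_zero_of_abs_lt_dvd h1
    (by rw [abs_lt]; constructor <;> split_ifs <;> omega)
  split_ifs at h2 <;> omega

/-- The cycle with `2 * a + 1` edge orbits and index `f`. -/
def shortCycle (A : CompositeData v k n a μ g) (f : ℕ) : BaseCycle v k where
  vtx j := pt v n g (shortPos a f (j % (2 * a + 1)) + (j / (2 * a + 1) : ℕ) * (2 * a + 1))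
    ((j % (2 * a + 1) % 2 : ℕ))
  len := 2 * a + 1
  shift := pt v n g (2 * a + 1) 0
  len_pos := by omega
  vtx_add_len j := by
    rw [pt_add, Nat.add_mod_right, Nat.add_div_right _ (by omega)]
    congr 1
    push_cast
    ring
  vtx_add_period j := by
    rw [A.hk, Nat.add_mul_mod_self_left, Nat.add_mul_div_left _ _ (by omega)]
    exact A.pt_congr _ ⟨1, by rw [A.hk]; push_cast; ring⟩
  inj i hi j hj h := by
    rw [Set.mem_Iio] at hi hj
    obtain ⟨h1, h2⟩ := A.pt_inj (by rw [abs_le]; constructor <;> omega) h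
    have hpk : (2 * a + 1 : ℤ) ∣ k := ⟨2 * μ + 1, by rw [A.hk]; push_cast; ring⟩
    rw [add_sub_add_comm, ← sub_mul] at h2
    have hr : i % (2 * a + 1) = j % (2 * a + 1) := by
      apply shortPos_inj (Nat.le_of_lt_succ (Nat.mod_lt _ (by omega)))
        (Nat.le_of_lt_succ (Nat.mod_lt _ (by omega))) (by exact_mod_cast h1)
      exact (Int.dvd_add_left (Dvd.intro_left _ rfl)).1 (hpk.trans h2)
    rw [hr, sub_self, zero_add, A.hk, mul_comm _ (2 * μ + 1)] at h2
    have hq : ∀ {i}, i < k → i / (2 * a + 1) < 2 * μ + 1 := by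
      intro i hi
      rw [A.hk] at hi
      exact Nat.div_lt_of_lt_mul hi
    have h4 : i / (2 * a + 1) = j / (2 * a + 1) := by
      have hqi := hq hi
      have hqj := hq hj
      generalize i / (2 * a + 1) = x at *
      generalize j / (2 * a + 1) = y at *
      push_cast at h2
      have h3 := Int.dvd_of_mul_dvd_mul_right (by positivity) h2
      have := Int.eq_zero_of_abs_lt_dvd h3 (by rw [abs_lt]; constructor <;> omega)
      omega
    rw [← Nat.div_add_mod i (2 * a + 1), ← Nat.div_add_mod j (2 * a + 1), hr, h4]

theorem shortCycle_vtx (A : CompositeData v k n a μ g) (f : ℕ) {r : ℕ} (hr : r < 2 * a + 1) :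
    (A.shortCycle f).vtx r = pt v n g (shortPos a f r) (r % 2 : ℕ) := by
  simp only [shortCycle]
  rw [Nat.mod_eq_of_lt hr, Nat.div_eq_of_lt hr]
  congr 1
  simp

theorem shortCycle_covers_up (A : CompositeData v k n a μ g) (f : ℕ) {r : ℕ} (hr : 1 ≤ r)
    (hr' : r ≤ 2 * a - 1) :
    (A.shortCycle f).Covers (pt v n g (r + (2 * a + 1) * f - (a + 1)) 1) := by
  refine ⟨2 * a - 1 - r, ?_⟩
  rw [BaseCycle.diff, A.shortCycle_vtx f (by omega), A.shortCycle_vtx f (by omega), pt_sub, neg_pt]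
  generalize hF : ((2 * a + 1 : ℤ) * f) = F
  rcases Nat.mod_two_eq_zero_or_one r with h1 | h1
  · right
    congr 1
    · unfold shortPos
      rw [hF]
      split_ifs <;> omega
    · omega
  · left
    congr 1
    · unfold shortPos
      rw [hF]
      split_ifs <;> omega
    · omega

theorem shortCycle_covers_down (A : CompositeData v k n a μ g) (f : ℕ) :
    (A.shortCycle f).Covers (pt v n g (-((2 * a + 1) * f) - (a + 1)) 1) := by
  have := A.ha
  refine ⟨2 * a - 1, Or.inr ?_⟩
  rw [BaseCycle.diff, A.shortCycle_vtx f (by omega), A.shortCycle_vtx f (by omega), pt_sub, neg_pt]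
  generalize hF : ((2 * a + 1 : ℤ) * f) = F
  congr 1
  · unfold shortPos
    rw [hF]
    split_ifs <;> omega
  · omega

theorem shortCycle_covers_flat (A : CompositeData v k n a μ g) (f : ℕ) :
    (A.shortCycle f).Covers (pt v n g (a + 1 - 2 * ((2 * a + 1) * f)) 0) := by
  refine ⟨2 * a, Or.inl ?_⟩
  have h1 : (A.shortCycle f).vtx (2 * a + 1) = (A.shortCycle f).vtx 0 + pt v n g (2 * a + 1) 0 := by
    have h0 := (A.shortCycle f).vtx_add_len 0
    rwa [zero_add] at h0
  rw [BaseCycle.diff, h1, A.shortCycle_vtx f (by omega), A.shortCycle_vtx f (by omega), pt_add,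
    pt_sub]
  have := A.ha
  generalize hF : ((2 * a + 1 : ℤ) * f) = F
  congr 1
  · unfold shortPos
    rw [hF]
    split_ifs <;> omega
  · omega

/-- The offset of the even vertices in the second half of the special cycle. -/
def jump (a μ t : ℕ) : ℤ := if t < μ + a - 1 then 0 else 1

/-- The factors of the ascending steps in the second half of the special cycle. -/
def wStep (a μ t : ℕ) : ℤ :=
  if t < μ then (2 * a + 1) * (μ - t)
  else if t < μ + a - 1 then 2 * a + 1 - 2 * (t - μ + 1)
  else -1 - 2 * (t + 1 - μ - a : ℕ) - ((t + 1 - μ - a) / a : ℕ)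

theorem wStep_strictAnti (ha : 1 ≤ a) (hμ : 1 ≤ μ) :
    StrictAnti fun t : ℕ => (a * μ : ℤ) + t + jump a μ t + wStep a μ t := by
  apply strictAnti_nat_of_succ_lt
  intro t
  unfold jump wStep
  have h1 : (t + 1 - μ - a) / a ≤ (t + 1 + 1 - μ - a) / a := Nat.div_le_div_right (by omega)
  have h2 : ((2 * a + 1) * (μ - t) : ℤ) = (2 * a + 1) * (μ - (t + 1 : ℕ)) + 2 * a + 1 := by
    push_cast
    ring
  have h3 : (0 : ℕ) / a = 0 := Nat.zero_div a
  by_cases hc1 : t + 1 < μ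
  · rw [if_pos (show t < μ by omega), if_pos hc1, if_pos (by omega), if_pos (by omega)]
    push_cast at *
    linarith [(by exact_mod_cast ha : (1 : ℤ) ≤ a)]
  · rw [if_neg hc1]
    by_cases hc2 : t < μ
    · obtain rfl : t = μ - 1 := by omega
      have h4 : ((2 * a + 1) * (μ - (μ - 1 : ℕ)) : ℤ) = 2 * a + 1 := by
        rw [Nat.cast_sub hμ]
        push_cast
        ring
      rw [if_pos hc2, h4, show (μ - 1 + 1 + 1 - μ - a) = 1 - a by omega,
        show (1 - a) / a = 0 from Nat.div_eq_of_lt (by omega)]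
      split_ifs <;> omega
    · rw [if_neg hc2]
      have h4 : t + 1 + 1 - μ - a = 0 → (t + 1 + 1 - μ - a) / a = 0 := by
        intro h
        rw [h, h3]
      generalize (t + 1 + 1 - μ - a) / a = y at *
      generalize (t + 1 - μ - a) / a = x at *
      split_ifs <;> omega

/-- The height of the `j`-th vertex of the special cycle. -/
def fullHeight (a μ j : ℕ) : ℤ :=
  if j ≤ 2 * (a * μ) then 0 else if (j - 2 * (a * μ) - 1) % 2 = 0 then -2 else -1

/-- The position of the `j`-th vertex of the special cycle. -/
def fullPos (a μ j : ℕ) : ℤ :=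
  if j ≤ 2 * (a * μ) then
    if j % 2 = 0 then (j / 2 : ℕ)
    else -(j / 2 : ℕ) - (j / 2 / a : ℕ) - (j / 2 / a % 2 : ℕ) - (a + 1)
  else if (j - 2 * (a * μ) - 1) % 2 = 0 then
    a * μ + (a + 1) + ((j - 2 * (a * μ) - 1) / 2 : ℕ) + jump a μ ((j - 2 * (a * μ) - 1) / 2)
  else
    a * μ + ((j - 2 * (a * μ) - 1) / 2 : ℕ) + jump a μ ((j - 2 * (a * μ) - 1) / 2)
      + wStep a μ ((j - 2 * (a * μ) - 1) / 2)

theorem k_eq (A : CompositeData v k n a μ g) : k = 4 * (a * μ) + 2 * a + 2 * μ + 1 := by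
  rw [A.hk]
  ring

theorem wStep_last (ha : 1 ≤ a) :
    wStep a μ (μ + a - 1 + a * μ) = -1 - 2 * (a * μ) - μ := by
  unfold wStep
  rw [if_neg (by omega), if_neg (by omega),
    show μ + a - 1 + a * μ + 1 - μ - a = a * μ by omega, Nat.mul_div_cancel_left _ (by omega)]
  push_cast
  ring

theorem wStep_zero (hμ : 1 ≤ μ) : wStep a μ 0 = 2 * (a * μ) + μ := by
  unfold wStep
  rw [if_pos (by omega)]
  push_cast
  ring

theorem jump_last : jump a μ (μ + a - 1 + a * μ) = 1 := by
  unfold jump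
  rw [if_neg (by omega)]

theorem fullPos_inj (A : CompositeData v k n a μ g) {i j : ℕ} (hi : i < k) (hj : j < k)
    (he : fullHeight a μ i = fullHeight a μ j) (hd : (k : ℤ) ∣ fullPos a μ i - fullPos a μ j) :
    i = j := by
  have ha := A.ha
  have hμ := A.hμ
  have hk := A.k_eq
  have hlast := wStep_last (μ := μ) ha
  have hlast' := jump_last (a := a) (μ := μ)
  have hfirst := wStep_zero (a := a) hμ
  have hanti := wStep_strictAnti ha hμ
  have hdiv : ∀ t < a * μ, t / a < μ := fun t ht => Nat.div_lt_of_lt_mul ht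
  have hmono : ∀ t t', t ≤ t' → t / a ≤ t' / a := fun t t' h => Nat.div_le_div_right h
  have hjump : ∀ t, 0 ≤ jump a μ t ∧ jump a μ t ≤ 1 := by
    intro t
    unfold jump
    split_ifs <;> omega
  have hjmono : ∀ t t', t ≤ t' → jump a μ t ≤ jump a μ t' := by
    intro t t' h
    unfold jump
    split_ifs <;> omega
  have hPcast : ((a * μ : ℕ) : ℤ) = a * μ := by push_cast; ring
  unfold fullHeight at he
  unfold fullPos at hd
  generalize hP : a * μ = P at *
  rw [← hPcast] at *
  by_cases hi0 : i ≤ 2 * P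
  · by_cases hj0 : j ≤ 2 * P
    · rw [if_pos hi0, if_pos hj0] at hd
      have hb : ∀ i ≤ 2 * P, i % 2 = 1 → i / 2 / a < μ := fun i hi h => hdiv _ (by omega)
      have hbi := hb i hi0
      have hbj := hb j hj0
      have hij := hmono (i / 2) (j / 2)
      have hji := hmono (j / 2) (i / 2)
      generalize i / 2 / a = x at *
      generalize j / 2 / a = y at *
      have h0 := Int.eq_zero_of_abs_lt_dvd hd
        (by rw [abs_lt]; constructor <;> split_ifs <;> omega)
      rcases le_total (i / 2) (j / 2) with h1 | h1
      · have h2 := hij h1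
        split_ifs at h0 <;> omega
      · have h2 := hji h1
        split_ifs at h0 <;> omega
    · rw [if_pos hi0, if_neg hj0] at he
      split_ifs at he
  · by_cases hj0 : j ≤ 2 * P
    · rw [if_neg hi0, if_pos hj0] at he
      split_ifs at he
    · rw [if_neg hi0, if_neg hj0] at he hd
      obtain ⟨i, rfl⟩ : ∃ i', i = i' + 2 * P + 1 := ⟨i - 2 * P - 1, by omega⟩
      obtain ⟨j, rfl⟩ : ∃ j', j = j' + 2 * P + 1 := ⟨j - 2 * P - 1, by omega⟩
      rw [show i + 2 * P + 1 - 2 * P - 1 = i by omega] at he hd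
      rw [show j + 2 * P + 1 - 2 * P - 1 = j by omega] at he hd
      have hji := hjump (i / 2)
      have hjj := hjump (j / 2)
      by_cases hpar : i % 2 = 0
      · have hpar' : j % 2 = 0 := by
          by_contra hcon
          rw [if_pos hpar, if_neg hcon] at he
          omega
        rw [if_pos hpar, if_pos hpar'] at hd
        have h0 := Int.eq_zero_of_abs_lt_dvd hd (by rw [abs_lt]; constructor <;> omega)
        rcases le_total (i / 2) (j / 2) with h1 | h1
        · have h2 := hjmono _ _ h1
          omega
        · have h2 := hjmono _ _ h1
          omega
      · have hpar' : ¬ j % 2 = 0 := by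
          intro hcon
          rw [if_neg hpar, if_pos hcon] at he
          omega
        rw [if_neg hpar, if_neg hpar'] at hd
        have hb : ∀ t, t ≤ μ + a - 1 + P →
            (a : ℤ) - 1 ≤ P + t + jump a μ t + wStep a μ t ∧
              P + t + jump a μ t + wStep a μ t ≤ 3 * P + μ := by
          intro t ht
          have h1 := hanti.antitone ht
          have h2 := hanti.antitone (Nat.zero_le t)
          have h3 : jump a μ 0 = 0 := by
            unfold jump
            rw [if_pos (by omega)]
          rw [hlast, hlast'] at h1
          rw [hfirst] at h2
          constructor
          · omega
          · omega
        have h1 := hb (i / 2) (by omega)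
        have h2 := hb (j / 2) (by omega)
        have h0 := Int.eq_zero_of_abs_lt_dvd hd (by rw [abs_lt]; constructor <;> omega)
        have := hanti.injective (sub_eq_zero.1 h0)
        omega

theorem fullPos_injOn (A : CompositeData v k n a μ g) :
    Set.InjOn (fun j => pt v n g (fullPos a μ j) (fullHeight a μ j)) (Set.Iio k) := by
  intro i hi j hj h
  obtain ⟨h1, h2⟩ := A.pt_inj
    (by rw [abs_le]; unfold fullHeight; constructor <;> split_ifs <;> omega) h
  exact A.fullPos_inj hi hj h1 h2

/-- The special cycle with trivial stabilizer. -/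
def fullCycle (A : CompositeData v k n a μ g) : BaseCycle v k :=
  BaseCycle.ofInjOn A.k_pos _ A.fullPos_injOn

theorem fullCycle_vtx (A : CompositeData v k n a μ g) {j : ℕ} (hj : j < k) :
    A.fullCycle.vtx j = pt v n g (fullPos a μ j) (fullHeight a μ j) := by
  simp only [fullCycle, BaseCycle.ofInjOn, Nat.mod_eq_of_lt hj]

theorem fullCycle_vtx_even (A : CompositeData v k n a μ g) {t : ℕ} (ht : t ≤ a * μ) :
    A.fullCycle.vtx (2 * t) = pt v n g t 0 := by
  have hk := A.k_eq
  rw [A.fullCycle_vtx (by omega), fullPos, fullHeight, if_pos (by omega), if_pos (by omega),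
    if_pos (by omega), Nat.mul_div_cancel_left _ (by omega)]

theorem fullCycle_vtx_odd (A : CompositeData v k n a μ g) {t : ℕ} (ht : t < a * μ) :
    A.fullCycle.vtx (2 * t + 1) =
      pt v n g (-t - (t / a : ℕ) - (t / a % 2 : ℕ) - (a + 1)) 0 := by
  have hk := A.k_eq
  rw [A.fullCycle_vtx (by omega), fullPos, fullHeight, if_pos (by omega), if_neg (by omega),
    if_pos (by omega), show (2 * t + 1) / 2 = t by omega]

theorem fullCycle_vtx_even' (A : CompositeData v k n a μ g) {t : ℕ} (ht : t ≤ μ + a - 1 + a * μ) :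
    A.fullCycle.vtx (2 * (a * μ) + 1 + 2 * t) =
      pt v n g (a * μ + (a + 1) + t + jump a μ t) (-2) := by
  have hk := A.k_eq
  have ha := A.ha
  rw [A.fullCycle_vtx (by omega), fullPos, fullHeight, if_neg (by omega), if_pos (by omega),
    if_neg (by omega), if_pos (by omega),
    show (2 * (a * μ) + 1 + 2 * t - 2 * (a * μ) - 1) / 2 = t by omega]

theorem fullCycle_vtx_odd' (A : CompositeData v k n a μ g) {t : ℕ} (ht : t ≤ μ + a - 1 + a * μ) :
    A.fullCycle.vtx (2 * (a * μ) + 2 + 2 * t) =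
      pt v n g (a * μ + t + jump a μ t + wStep a μ t) (-1) := by
  have hk := A.k_eq
  have ha := A.ha
  rw [A.fullCycle_vtx (by omega), fullPos, fullHeight, if_neg (by omega), if_neg (by omega),
    if_neg (by omega), if_neg (by omega),
    show (2 * (a * μ) + 2 + 2 * t - 2 * (a * μ) - 1) / 2 = t by omega]

theorem fullCycle_covers_flat (A : CompositeData v k n a μ g) {t : ℕ} (ht : t < a * μ) :
    A.fullCycle.Covers (pt v n g (2 * t + (t / a : ℕ) + (t / a % 2 : ℕ) + (a + 1)) 0) := by
  refine ⟨2 * t, Or.inr ?_⟩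
  rw [BaseCycle.diff, A.fullCycle_vtx_even ht.le, A.fullCycle_vtx_odd ht, pt_sub, neg_pt]
  congr 1
  ring

theorem fullCycle_covers_flat' (A : CompositeData v k n a μ g) {t : ℕ} (ht : t < a * μ) :
    A.fullCycle.Covers (pt v n g (2 * t + 1 + (t / a : ℕ) + (t / a % 2 : ℕ) + (a + 1)) 0) := by
  refine ⟨2 * t + 1, Or.inl ?_⟩
  rw [BaseCycle.diff, show 2 * t + 1 + 1 = 2 * (t + 1) by ring, A.fullCycle_vtx_even ht,
    A.fullCycle_vtx_odd ht, pt_sub]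
  congr 1
  push_cast
  ring

theorem fullCycle_covers_steep (A : CompositeData v k n a μ g) :
    A.fullCycle.Covers (pt v n g (-(a + 1)) 2) := by
  refine ⟨2 * (a * μ), Or.inr ?_⟩
  have h1 := A.fullCycle_vtx_even' (t := 0) (by omega)
  have hj : jump a μ 0 = 0 := by
    have := A.ha
    have := A.hμ
    rw [jump, if_pos (by omega)]
  rw [mul_zero, add_zero] at h1
  rw [BaseCycle.diff, h1, A.fullCycle_vtx_even le_rfl, pt_sub, neg_pt, hj]
  congr 1
  push_cast
  ring

theorem fullCycle_covers_up (A : CompositeData v k n a μ g) {t : ℕ}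
    (ht : t ≤ μ + a - 1 + a * μ) :
    A.fullCycle.Covers (pt v n g (wStep a μ t - (a + 1)) 1) := by
  refine ⟨2 * (a * μ) + 1 + 2 * t, Or.inl ?_⟩
  rw [BaseCycle.diff, A.fullCycle_vtx_even' ht,
    show 2 * (a * μ) + 1 + 2 * t + 1 = 2 * (a * μ) + 2 + 2 * t by ring, A.fullCycle_vtx_odd' ht,
    pt_sub]
  congr 1
  ring

theorem fullCycle_covers_down (A : CompositeData v k n a μ g) {t : ℕ}
    (ht : t < μ + a - 1 + a * μ) :
    A.fullCycle.Covers
      (pt v n g (wStep a μ t - 1 - (jump a μ (t + 1) - jump a μ t) - (a + 1)) 1) := by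
  refine ⟨2 * (a * μ) + 2 + 2 * t, Or.inr ?_⟩
  rw [BaseCycle.diff, A.fullCycle_vtx_odd' ht.le,
    show 2 * (a * μ) + 2 + 2 * t + 1 = 2 * (a * μ) + 1 + 2 * (t + 1) by ring,
    A.fullCycle_vtx_even' ht, pt_sub, neg_pt]
  congr 1
  push_cast
  ring

theorem fullCycle_covers_last (A : CompositeData v k n a μ g) :
    A.fullCycle.Covers (pt v n g (2 - (a + 1)) 1) := by
  have hk := A.k_eq
  have ha := A.ha
  refine ⟨2 * (a * μ) + 2 + 2 * (μ + a - 1 + a * μ), Or.inl ?_⟩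
  have h1 : A.fullCycle.vtx (2 * (a * μ) + 2 + 2 * (μ + a - 1 + a * μ) + 1) = pt v n g 0 0 := by
    have h2 := A.fullCycle.vtx_add_period (2 * 0)
    rw [A.fullCycle_vtx_even (by omega)] at h2
    rw [show 2 * (a * μ) + 2 + 2 * (μ + a - 1 + a * μ) + 1 = 2 * 0 + k by omega, h2]
    rfl
  rw [BaseCycle.diff, h1, A.fullCycle_vtx_odd' le_rfl, pt_sub, wStep_last ha, jump_last]
  congr 1
  push_cast [Nat.cast_sub (show 1 ≤ μ + a by omega)]
  ring

/-- The auxiliary base cycles for a composite cycle length. -/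
def auxCycle (A : CompositeData v k n a μ g) : Option (Fin a ⊕ Fin μ) → BaseCycle v k
  | none => A.fullCycle
  | some (Sum.inl x) => multCycle A.hv (by omega)
      ((A.hcop (x + 1) (by omega) (by omega)).mul_right A.isCoprime_inv)
  | some (Sum.inr f) => A.shortCycle (f + 1)

theorem sum_auxCycle_len (A : CompositeData v k n a μ g) :
    2 * ∑ b, (A.auxCycle b).len = 3 * k - 1 := by
  have h1 : A.fullCycle.len = k := rfl
  have h2 : ∀ f, (A.shortCycle f).len = 2 * a + 1 := fun _ => rfl
  have hk := A.k_eq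
  rw [Fintype.sum_option, Fintype.sum_sum_type]
  simp only [auxCycle, h1, h2, multCycle, Finset.sum_const, Finset.card_univ, Fintype.card_fin,
    smul_eq_mul]
  have h3 : μ * (2 * a + 1) = 2 * (a * μ) + μ := by ring
  omega

theorem exists_covers_flat_of_lt (A : CompositeData v k n a μ g) {y : ℕ} (hy : 1 ≤ y)
    (hyk : 2 * y < k) : ∃ b, (A.auxCycle b).Covers (pt v n g y 0) := by
  have hk := A.k_eq
  have ha := A.ha
  rcases Nat.lt_or_ge a y with h1 | h1
  · obtain ⟨e, r, hr, hyer⟩ : ∃ e r, r ≤ 2 * a ∧ y = 2 * (a * e) + e + r + (a + 1) :=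
      ⟨(y - (a + 1)) / (2 * a + 1), (y - (a + 1)) % (2 * a + 1),
        Nat.le_of_lt_succ (Nat.mod_lt _ (by omega)), by
          have h2 := Nat.div_add_mod (y - (a + 1)) (2 * a + 1)
          have h3 : ∀ x, (2 * a + 1) * x = 2 * (a * x) + x := fun x => by ring
          rw [h3] at h2
          omega⟩
    have he : e < μ := by
      by_contra hcon
      have := Nat.mul_le_mul_left a (not_lt.1 hcon)
      omega
    have hae : a * e + a ≤ a * μ := by
      have := Nat.mul_le_mul_left a he
      rwa [Nat.mul_succ] at this
    have hflat : ∀ s < 2 * a, y = 2 * (a * e) + s + e + e % 2 + (a + 1) →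
        ∃ b, (A.auxCycle b).Covers (pt v n g y 0) := by
      intro s hs hys
      refine ⟨none, ?_⟩
      have hdiv : (a * e + s / 2) / a = e := by
        rw [Nat.mul_add_div (by omega), Nat.div_eq_of_lt (by omega), add_zero]
      rcases Nat.mod_two_eq_zero_or_one s with h2 | h2
      · have h3 := A.fullCycle_covers_flat (t := a * e + s / 2) (by omega)
        rw [hdiv] at h3
        change A.fullCycle.Covers _
        clear hdiv
        convert h3 using 2
        omega
      · have h3 := A.fullCycle_covers_flat' (t := a * e + s / 2) (by omega)
        rw [hdiv] at h3
        change A.fullCycle.Covers _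
        clear hdiv
        convert h3 using 2
        omega
    rcases Nat.mod_two_eq_zero_or_one e with he2 | he2
    · rcases Nat.lt_or_ge r (2 * a) with hr2 | hr2
      · exact hflat r hr2 (by omega)
      · obtain ⟨f, rfl⟩ : ∃ f, e = 2 * f := ⟨e / 2, by omega⟩
        refine ⟨some (Sum.inr ⟨f, by omega⟩), ?_⟩
        change (A.shortCycle (f + 1)).Covers _
        convert (A.shortCycle_covers_flat (f + 1)).neg_right using 1
        rw [neg_pt]
        congr 1
        rw [hyer, show r = 2 * a by omega]
        push_cast
        ring
    · rcases Nat.eq_zero_or_pos r with hr2 | hr2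
      · obtain ⟨f, hf⟩ : ∃ f, e + 2 * f = 2 * μ - 1 := ⟨(2 * μ - 1 - e) / 2, by omega⟩
        refine ⟨some (Sum.inr ⟨f, by omega⟩), ?_⟩
        change (A.shortCycle (f + 1)).Covers _
        convert A.shortCycle_covers_flat (f + 1) using 1
        apply A.pt_congr
        refine ⟨1, ?_⟩
        have hf' : (e : ℤ) + 2 * f = 2 * μ - 1 := by omega
        rw [hyer, hr2, A.hk]
        push_cast
        linear_combination (2 * a + 1 : ℤ) * hf'
      · exact hflat (r - 1) (by omega) (by omega)
  · refine ⟨some (Sum.inl ⟨y - 1, by omega⟩), ?_⟩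
    have h2 := multCycle_covers A.hv (by omega)
      ((A.hcop (y - 1 + 1) (by omega) (by omega)).mul_right A.isCoprime_inv)
    have h3 : pt v n g y 0 = (((y - 1 + 1 : ℕ) * g * (2 * n + 1 : ℕ) : ℤ) : ZMod v) := by
      unfold pt
      rw [Nat.sub_add_cancel hy]
      congr 1
      ring
    rw [h3]
    exact h2

theorem exists_covers_flat (A : CompositeData v k n a μ g) {z : ℤ} (hz : ¬ (k : ℤ) ∣ z) :
    ∃ b, (A.auxCycle b).Covers (pt v n g z 0) := by
  have hk := A.k_eq
  have hk0 : (k : ℤ) ≠ 0 := by have := A.k_pos; omega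
  have h0 := Int.emod_nonneg z hk0
  have h1 := Int.emod_lt_of_pos z (show (0 : ℤ) < k by omega)
  have h2 : (k : ℤ) ∣ z - z % k := Int.dvd_self_sub_emod
  have h3 : z % k ≠ 0 := fun h => hz (Int.dvd_of_emod_eq_zero h)
  generalize z % k = y at *
  lift y to ℕ using h0
  rw [A.pt_congr 0 h2]
  rcases Nat.lt_or_ge (2 * y) k with h4 | h4
  · exact A.exists_covers_flat_of_lt (by omega) h4
  · obtain ⟨b, hb⟩ := A.exists_covers_flat_of_lt (y := k - y) (by omega) (by omega)
    refine ⟨b, ?_⟩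
    convert hb.neg_right using 1
    rw [neg_pt, neg_zero]
    exact A.pt_congr 0 ⟨1, by rw [Nat.cast_sub (by omega)]; ring⟩

theorem exists_covers_up (A : CompositeData v k n a μ g) {w : ℤ} (hw : ¬ (k : ℤ) ∣ w) :
    ∃ b, (A.auxCycle b).Covers (pt v n g (w - (a + 1)) 1) := by
  have hk := A.k_eq
  have ha := A.ha
  have hμ := A.hμ
  have hk0 : (k : ℤ) ≠ 0 := by have := A.k_pos; omega
  have hup : ∀ t, t ≤ μ + a - 1 + a * μ → ∀ x, wStep a μ t = x →
      ∃ b, (A.auxCycle b).Covers (pt v n g (x - (a + 1)) 1) := by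
    rintro t ht _ rfl
    exact ⟨none, A.fullCycle_covers_up ht⟩
  have hdown : ∀ t, t < μ + a - 1 + a * μ → ∀ x,
      wStep a μ t - 1 - (jump a μ (t + 1) - jump a μ t) = x →
      ∃ b, (A.auxCycle b).Covers (pt v n g (x - (a + 1)) 1) := by
    rintro t ht _ rfl
    exact ⟨none, A.fullCycle_covers_down ht⟩
  obtain ⟨F, r, hr, hF, hd⟩ : ∃ F r : ℕ, r ≤ 2 * a ∧ F ≤ 2 * μ ∧
      (k : ℤ) ∣ w - ((2 * a + 1) * (F - μ) + r - 1) := by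
    have h0 := Int.emod_nonneg (w + 1 + (2 * a + 1) * μ) hk0
    have h1 := Int.emod_lt_of_pos (w + 1 + (2 * a + 1) * μ) (show (0 : ℤ) < k by omega)
    have h2 : (k : ℤ) ∣ (w + 1 + (2 * a + 1) * μ) - (w + 1 + (2 * a + 1) * μ) % k :=
      Int.dvd_self_sub_emod
    generalize (w + 1 + (2 * a + 1) * μ) % (k : ℤ) = y at *
    lift y to ℕ using h0
    refine ⟨y / (2 * a + 1), y % (2 * a + 1), Nat.le_of_lt_succ (Nat.mod_lt _ (by omega)),
      Nat.le_of_lt_succ (Nat.div_lt_of_lt_mul ?_), ?_⟩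
    · rw [← A.hk]
      exact_mod_cast h1
    · convert h2 using 1
      have h3 : ((2 * a + 1 : ℤ) * (y / (2 * a + 1) : ℕ) + (y % (2 * a + 1) : ℕ)) = y := by
        exact_mod_cast Nat.div_add_mod y (2 * a + 1)
      linear_combination -h3
  have hcongr : pt v n g (w - (a + 1)) 1 =
      pt v n g ((2 * a + 1) * (F - μ) + r - 1 - (a + 1)) 1 :=
    A.pt_congr _ (by rwa [sub_sub_sub_cancel_right])
  rw [hcongr]
  rcases lt_trichotomy F μ with hFμ | hFμ | hFμ
  · obtain ⟨f, hf⟩ : ∃ f, μ = F + (f + 1) := ⟨μ - F - 1, by omega⟩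
    have haf : a * f + a ≤ a * μ := by
      have := Nat.mul_le_mul_left a (show f + 1 ≤ μ by omega)
      rwa [Nat.mul_succ] at this
    have hx : (2 * a + 1 : ℤ) * (F - μ) = -(2 * (a * f : ℕ) + 2 * a + f + 1) := by
      rw [hf]
      push_cast
      ring
    have hw : ∀ x ≤ a * μ, wStep a μ (μ + a - 1 + x) = -1 - 2 * x - (x / a : ℕ) := by
      intro x _
      unfold wStep
      rw [if_neg (by omega), if_neg (by omega), show μ + a - 1 + x + 1 - μ - a = x by omega]
    have hj : ∀ x, jump a μ (μ + a - 1 + x) = 1 := by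
      intro x
      rw [jump, if_neg (by omega)]
    rcases Nat.lt_or_ge r 2 with h2 | h2
    · rcases Nat.eq_zero_or_pos r with h3 | h3
      · apply hup (μ + a - 1 + (a * f + a)) (by omega)
        rw [hw _ haf, show a * f + a = a * (f + 1) by ring, Nat.mul_div_cancel_left _ (by omega),
          hx, h3]
        push_cast
        ring
      · refine ⟨some (Sum.inr ⟨f, by omega⟩), ?_⟩
        change (A.shortCycle (f + 1)).Covers _
        convert A.shortCycle_covers_down (f + 1) using 2
        rw [hx, show r = 1 by omega]
        push_cast
        ring
    · obtain ⟨s, hs⟩ : ∃ s, s + r = 2 * a + 1 := ⟨2 * a + 1 - r, by omega⟩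
      have hdiv : (a * f + s / 2) / a = f := by
        rw [Nat.mul_add_div (by omega), Nat.div_eq_of_lt (by omega), add_zero]
      rcases Nat.mod_two_eq_zero_or_one s with h3 | h3
      · apply hup (μ + a - 1 + (a * f + s / 2)) (by omega)
        rw [hw _ (by omega), hdiv, hx]
        omega
      · apply hdown (μ + a - 1 + (a * f + s / 2)) (by omega)
        rw [hw _ (by omega), hdiv, hx, hj, add_assoc, hj]
        omega
  · have hx : (2 * a + 1 : ℤ) * (F - μ) = 0 := by
      rw [hFμ]
      ring
    rw [hx, zero_add] at hd ⊢
    have hw0 : r ≠ 1 := by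
      rintro rfl
      apply hw
      simpa using hd
    have hw1 : ∀ t, μ ≤ t + 1 → t < μ + a - 1 → wStep a μ t = 2 * a + 1 - 2 * (t + 1 - μ : ℕ) := by
      intro t h1 h2
      unfold wStep
      split_ifs with h3
      · rw [show (t + 1 - μ : ℕ) = 0 by omega, show (μ : ℤ) - t = 1 by omega]
        push_cast
        ring
      · omega
    by_cases h0 : r = 0
    · apply hup (μ + a - 1) (by omega)
      unfold wStep
      rw [if_neg (by omega), if_neg (by omega), show μ + a - 1 + 1 - μ - a = 0 by omega, h0,
        Nat.zero_div]
      simp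
    by_cases h2 : r = 2
    · apply hdown (μ + a - 2) (by omega)
      rw [hw1 _ (by omega) (by omega), jump, jump]
      split_ifs <;> omega
    by_cases h3 : r = 3
    · refine ⟨none, ?_⟩
      change A.fullCycle.Covers _
      convert A.fullCycle_covers_last using 2
      rw [h3]
      norm_num
    rcases Nat.mod_two_eq_zero_or_one r with h4 | h4
    · apply hup (μ - 1 + (2 * a + 2 - r) / 2) (by omega)
      rw [hw1 _ (by omega) (by omega)]
      omega
    · apply hdown (μ - 1 + (2 * a + 1 - r) / 2) (by omega)
      rw [hw1 _ (by omega) (by omega), jump, jump]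
      split_ifs <;> omega
  · obtain ⟨f, hf⟩ : ∃ f, F = μ + (f + 1) := ⟨F - μ - 1, by omega⟩
    have hx : (2 * a + 1 : ℤ) * (F - μ) = (2 * a + 1) * (f + 1) := by
      rw [hf]
      push_cast
      ring
    rw [hx]
    have hw1 : wStep a μ (μ - (f + 1)) = (2 * a + 1) * (f + 1) := by
      rw [wStep, if_pos (by omega), Nat.cast_sub (by omega)]
      push_cast
      ring
    rcases Nat.lt_or_ge r 2 with h2 | h2
    · rcases Nat.eq_zero_or_pos r with h3 | h3
      · by_cases h4 : f = 0 ∧ a = 1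
        · refine ⟨none, ?_⟩
          change A.fullCycle.Covers _
          convert A.fullCycle_covers_last using 2
          rw [h3, h4.1, h4.2]
          norm_num
        · apply hdown (μ - (f + 1)) (by omega)
          rw [hw1, jump, jump, if_pos (by omega), if_pos (by omega), h3]
          push_cast
          ring
      · apply hup (μ - (f + 1)) (by omega)
        rw [hw1, show r = 1 by omega]
        push_cast
        ring
    · refine ⟨some (Sum.inr ⟨f, by omega⟩), ?_⟩
      change (A.shortCycle (f + 1)).Covers _
      convert A.shortCycle_covers_up (f + 1) (r := r - 1) (by omega) (by omega) using 2
      rw [Nat.cast_sub (by omega)]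
      push_cast
      ring

theorem exists_covers_steep (A : CompositeData v k n a μ g) :
    ∃ b, (A.auxCycle b).Covers (pt v n g (-(a + 1)) 2) :=
  ⟨none, A.fullCycle_covers_steep⟩

end CompositeData

end AuxiliaryCycles

section Construction

variable {v h n : ℕ}

theorem isCoprime_of_lt_minFac {k x : ℕ} (hx : x ≠ 0) (hxk : x < k.minFac) :
    IsCoprime (k : ℤ) (x : ℤ) := by
  rw [Nat.isCoprime_iff_coprime]
  exact Nat.coprime_of_lt_minFac hx hxk

theorem exists_auxiliary_of_prime (hv : v = (2 * h + 1) * (2 * n + 1)) (hh : 3 ≤ h) (hn : 2 ≤ n)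
    (hp : (2 * h + 1).Prime) :
    ∃ c : Option (Fin h) → BaseCycle v (2 * h + 1), 2 * ∑ a, (c a).len = 3 * (2 * h + 1) - 1 ∧
      (∀ s : ℤ, ¬ ((2 * h + 1 : ℕ) : ℤ) ∣ s →
        ∃ a, (c a).Covers ((s * (2 * n + 1 : ℕ) : ℤ) : ZMod v)) ∧
      (∀ x : ℤ, ¬ ((2 * h + 1 : ℕ) : ℤ) ∣ x →
        ∃ a, (c a).Covers (((x - (h + 1)) * (2 * n + 1 : ℕ) + 2 : ℤ) : ZMod v)) ∧
      ∃ a, (c a).Covers (colEnd v h n 2) := by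
  have hcop : ∀ x : Fin h, IsCoprime ((2 * h + 1 : ℕ) : ℤ) ((x + 1 : ℕ) : ℤ) := fun x =>
    isCoprime_of_lt_minFac (by omega) (by rw [hp.minFac_eq]; omega)
  have hok : ColOK h n 2 (2 * h) := ⟨by omega, by omega, by omega, le_rfl, Or.inl rfl⟩
  let c : Option (Fin h) → BaseCycle v (2 * h + 1) := fun b =>
    b.elim (colCycle hv hh hok) fun x => multCycle hv (by omega) (hcop x)
  have hc : ∀ y : ℕ, 1 ≤ y → y ≤ h →
      ∃ b, (c b).Covers (((y : ℤ) * (2 * n + 1 : ℕ) : ℤ) : ZMod v) := by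
    intro y hy hyh
    have h1 := multCycle_covers hv (by omega) (hcop ⟨y - 1, by omega⟩)
    refine ⟨some ⟨y - 1, by omega⟩, ?_⟩
    rw [show ((y : ℤ)) = ((y - 1 + 1 : ℕ) : ℤ) by omega]
    exact h1
  refine ⟨c, ?_, ?_, ?_, none, colCycle_covers_colEnd hv hh hok⟩
  · have h1 : (colCycle hv hh hok).len = 2 * h + 1 := rfl
    rw [Fintype.sum_option]
    simp only [c, Option.elim_none, Option.elim_some, h1, multCycle, Finset.sum_const,
      Finset.card_univ, Fintype.card_fin, smul_eq_mul]
    omega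
  · intro s hs
    have h0 := Int.emod_nonneg s (show ((2 * h + 1 : ℕ) : ℤ) ≠ 0 by omega)
    have h1 := Int.emod_lt_of_pos s (show (0 : ℤ) < (2 * h + 1 : ℕ) by omega)
    have h2 : ((2 * h + 1 : ℕ) : ℤ) ∣ s - s % (2 * h + 1 : ℕ) := Int.dvd_self_sub_emod
    have h3 : s % (2 * h + 1 : ℕ) ≠ 0 := fun h => hs (Int.dvd_of_emod_eq_zero h)
    generalize s % ((2 * h + 1 : ℕ) : ℤ) = y at *
    lift y to ℕ using h0
    rcases Nat.lt_or_ge h y with h4 | h4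
    · obtain ⟨b, hb⟩ := hc (2 * h + 1 - y) (by omega) (by omega)
      refine ⟨b, ?_⟩
      convert hb.neg_right using 1
      have h5 := intCast_mul_eq hv 0 (s := s) (s' := -((2 * h + 1 - y : ℕ) : ℤ)) (by
        rw [Nat.cast_sub (by omega), sub_neg_eq_add, ← add_sub_assoc, add_sub_right_comm]
        exact dvd_add h2 dvd_rfl)
      rw [add_zero, add_zero] at h5
      rw [h5, neg_mul, Int.cast_neg]
    · obtain ⟨b, hb⟩ := hc y (by omega) h4
      refine ⟨b, ?_⟩
      convert hb using 1
      have h5 := intCast_mul_eq hv 0 h2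
      rwa [add_zero, add_zero] at h5
  · exact fun x hx => ⟨none, colCycle_covers hv hh hok hx⟩

theorem exists_compositeData (hv : v = (2 * h + 1) * (2 * n + 1)) (hh : 3 ≤ h) (hn : 2 ≤ n)
    (hp : ¬ (2 * h + 1).Prime) : ∃ a μ g, CompositeData v (2 * h + 1) n a μ g ∧
      IsCoprime ((2 * h + 1 : ℕ) : ℤ) (2 * a + 2) := by
  have hpk : (2 * h + 1).minFac.Prime := Nat.minFac_prime (by omega)
  have hodd : (2 * h + 1).minFac % 2 = 1 := by
    have := (show Odd (2 * h + 1) from ⟨h, rfl⟩).of_dvd_nat (Nat.minFac_dvd (2 * h + 1))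
    exact Nat.odd_iff.1 this
  obtain ⟨a, ha⟩ : ∃ a, (2 * h + 1).minFac = 2 * a + 1 := ⟨(2 * h + 1).minFac / 2, by omega⟩
  obtain ⟨m, hm⟩ := Nat.minFac_dvd (2 * h + 1)
  have hm1 : m ≠ 1 := by
    rintro rfl
    rw [mul_one] at hm
    rw [hm] at hp
    exact hp (Nat.minFac_prime (by omega))
  have hmodd : m % 2 = 1 := by
    have := (show Odd (2 * h + 1) from ⟨h, rfl⟩).of_dvd_nat (Dvd.intro_left _ hm.symm)
    exact Nat.odd_iff.1 this
  obtain ⟨μ, rfl⟩ : ∃ μ, m = 2 * μ + 1 := ⟨m / 2, by omega⟩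
  have h2 := hpk.two_le
  have hcop : ∀ x : ℕ, 1 ≤ x → x ≤ 2 * a → IsCoprime ((2 * h + 1 : ℕ) : ℤ) (x : ℤ) :=
    fun x hx hxa => isCoprime_of_lt_minFac (by omega) (by omega)
  have hcop2 : IsCoprime ((2 * h + 1 : ℕ) : ℤ) (2 * a + 2) := by
    have h3 := (hcop 2 (by omega) (by omega)).mul_right (hcop (a + 1) (by omega) (by omega))
    convert h3 using 1
    push_cast
    ring
  obtain ⟨x, g, hg⟩ := hcop2
  exact ⟨a, μ, g, ⟨hv, by rw [← ha]; exact hm, by omega, by omega, hn, ⟨-x, by linear_combination hg⟩,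
    fun x h3 h4 => hcop x h3 (by omega)⟩, x, g, hg⟩

theorem exists_auxiliary (hv : v = (2 * h + 1) * (2 * n + 1)) (hh : 3 ≤ h) (hn : 2 ≤ n) :
    ∃ (ι : Type) (_ : Fintype ι) (c : ι → BaseCycle v (2 * h + 1)),
      2 * ∑ a, (c a).len = 3 * (2 * h + 1) - 1 ∧
      (∀ s : ℤ, ¬ ((2 * h + 1 : ℕ) : ℤ) ∣ s →
        ∃ a, (c a).Covers ((s * (2 * n + 1 : ℕ) : ℤ) : ZMod v)) ∧
      (∀ x : ℤ, ¬ ((2 * h + 1 : ℕ) : ℤ) ∣ x →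
        ∃ a, (c a).Covers (((x - (h + 1)) * (2 * n + 1 : ℕ) + 2 : ℤ) : ZMod v)) ∧
      ∃ a, (c a).Covers (colEnd v h n 2) := by
  by_cases hp : (2 * h + 1).Prime
  · obtain ⟨c, hc⟩ := exists_auxiliary_of_prime hv hh hn hp
    exact ⟨_, inferInstance, c, hc⟩
  obtain ⟨a, μ, g, A, hcop⟩ := exists_compositeData hv hh hn hp
  obtain ⟨c, hc⟩ := A.hg
  push_cast at hc
  have hinv : ((2 * h + 1 : ℕ) : ℤ) ∣ (a + 1) * g - (h + 1) :=
    ⟨(h + 1) * c - (a + 1) * g, by push_cast; linear_combination (h + 1 : ℤ) * hc⟩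
  refine ⟨_, inferInstance, A.auxCycle, A.sum_auxCycle_len, fun s hs => ?_, fun x hx => ?_, ?_⟩
  · obtain ⟨b, hb⟩ := A.exists_covers_flat (z := s * (2 * a + 2))
      fun hd => hs (hcop.dvd_of_dvd_mul_right hd)
    refine ⟨b, ?_⟩
    convert hb using 1
    have h1 := intCast_mul_eq hv 0 (s := s) (s' := s * (2 * a + 2) * g)
      ⟨-s * c, by push_cast; linear_combination -s * hc⟩
    rw [add_zero] at h1
    rw [h1, pt, zero_mul]
  · obtain ⟨b, hb⟩ := A.exists_covers_up (w := x * (2 * a + 2))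
      fun hd => hx (hcop.dvd_of_dvd_mul_right hd)
    refine ⟨b, ?_⟩
    convert hb using 1
    rw [pt, one_mul]
    refine intCast_mul_eq hv _ ?_
    obtain ⟨e, he⟩ := hinv
    exact ⟨e - x * c, by push_cast at *; linear_combination he - x * hc⟩
  · obtain ⟨b, hb⟩ := A.exists_covers_steep
    refine ⟨b, ?_⟩
    convert hb using 1
    rw [pt, colEnd, mul_comm (2 : ℤ) 2]
    refine intCast_mul_eq hv _ ?_
    obtain ⟨e, he⟩ := hinv
    exact ⟨e, by push_cast at *; linear_combination he⟩

theorem exists_covers_of_columns {κ : Type*} {c : κ → BaseCycle v (2 * h + 1)}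
    (hv : v = (2 * h + 1) * (2 * n + 1))
    (hzero : ∀ s : ℤ, ¬ ((2 * h + 1 : ℕ) : ℤ) ∣ s →
      ∃ a, (c a).Covers ((s * (2 * n + 1 : ℕ) : ℤ) : ZMod v))
    (hcol : ∀ i : ℕ, 1 ≤ i → i ≤ n → ∀ x : ℤ, ¬ ((2 * h + 1 : ℕ) : ℤ) ∣ x →
      ∃ a, (c a).Covers (((x - (h + 1)) * (2 * n + 1 : ℕ) + i : ℤ) : ZMod v))
    (hend : ∀ i : ℕ, 1 ≤ i → i ≤ n → ∃ a, (c a).Covers (colEnd v h n i))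
    {d : ZMod v} (hd : d ≠ 0) : ∃ a, (c a).Covers d := by
  have hpos : ∀ (b : ℤ) (i : ℕ), 1 ≤ i → i ≤ n →
      ∃ a, (c a).Covers ((b * (2 * n + 1 : ℕ) + i : ℤ) : ZMod v) := by
    intro b i hi hin
    by_cases hx : ((2 * h + 1 : ℕ) : ℤ) ∣ b + (h + 1)
    · rcases Nat.even_or_odd' i with ⟨j, rfl | rfl⟩
      · obtain ⟨a, ha⟩ := hend j (by omega) (by omega)
        refine ⟨a, ?_⟩
        convert ha using 1
        rw [colEnd]
        push_cast
        have h1 := intCast_mul_eq hv (2 * j) (s := b) (s' := -(h + 1)) (by rwa [sub_neg_eq_add])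
        push_cast at h1
        exact h1
      · obtain ⟨a, ha⟩ := hend (n - j) (by omega) (by omega)
        refine ⟨a, ?_⟩
        convert ha.neg_right using 1
        have h1 := intCast_mul_eq hv (-(2 * (n - j : ℕ))) (s := b + 1) (s' := h + 1) (by
          rw [show (b + 1 - (h + 1) : ℤ) = b + (h + 1) - (2 * h + 1 : ℕ) by push_cast; ring]
          exact hx.sub dvd_rfl)
        rw [colEnd, ← Int.cast_neg]
        convert h1 using 2
        · rw [Nat.cast_sub (by omega)]
          push_cast
          ring
        · ring
    · obtain ⟨a, ha⟩ := hcol i hi hin _ hx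
      exact ⟨a, by rwa [add_sub_cancel_right] at ha⟩
  obtain ⟨N, rfl⟩ := ZMod.intCast_surjective d
  have hL : (0 : ℤ) < (2 * n + 1 : ℕ) := by omega
  have h0 := Int.emod_nonneg N hL.ne'
  have h1 := Int.emod_lt_of_pos N hL
  have h2 := Int.mul_ediv_add_emod N (2 * n + 1 : ℕ)
  generalize N / ((2 * n + 1 : ℕ) : ℤ) = b at *
  generalize N % ((2 * n + 1 : ℕ) : ℤ) = r at *
  lift r to ℕ using h0
  rw [mul_comm] at h2
  rw [← h2] at hd ⊢
  rcases Nat.eq_zero_or_pos r with rfl | hr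
  · rw [Nat.cast_zero, add_zero] at hd ⊢
    apply hzero
    intro hk
    apply hd
    have h3 := intCast_mul_eq hv 0 (s := b) (s' := 0) (by rwa [sub_zero])
    simpa only [add_zero, zero_mul, Int.cast_zero] using h3
  · rcases Nat.lt_or_ge n r with hn | hn
    · obtain ⟨a, ha⟩ := hpos (-b - 1) (2 * n + 1 - r) (by omega) (by omega)
      refine ⟨a, ?_⟩
      convert ha.neg_right using 1
      rw [← Int.cast_neg]
      congr 1
      rw [Nat.cast_sub (by omega)]
      ring
    · exact hpos b r hr hn

/-- The columns whose cycles are chosen freely. -/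
def freeCols (n : ℕ) : Finset ℕ := {i ∈ Finset.Icc 3 n | 3 * i ≠ 2 * n + 1}

theorem card_freeCols (n : ℕ) : n - 3 ≤ (freeCols n).card := by
  have h1 : (Finset.Icc 3 n).erase ((2 * n + 1) / 3) ⊆ freeCols n := by
    intro i
    simp only [freeCols, Finset.mem_erase, Finset.mem_filter]
    exact fun hi => ⟨hi.2, by omega⟩
  have h2 := Finset.card_le_card h1
  have h3 := Finset.pred_card_le_card_erase (s := Finset.Icc 3 n) (a := (2 * n + 1) / 3)
  rw [Nat.card_Icc] at h3
  omega

/-- The place of insertion in column `i` prescribed by the choice `φ`. -/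
def slot (h : ℕ) (φ : freeCols n → Fin 6 × Bool) (i : ℕ) : ℕ :=
  if hi : i ∈ freeCols n then (φ ⟨i, hi⟩).1 + 1 else 2 * h

/-- The orientation in column `i` prescribed by the choice `φ`. -/
def orient (φ : freeCols n → Fin 6 × Bool) (i : ℕ) : Bool :=
  if hi : i ∈ freeCols n then (φ ⟨i, hi⟩).2 else false

theorem colOK_slot (hh : 3 ≤ h) (φ : freeCols n → Fin 6 × Bool) {i : ℕ}
    (hi : i ∈ (Finset.Icc 1 n).erase 2) : ColOK h n i (slot h φ i) := by
  simp only [Finset.mem_erase, Finset.mem_Icc] at hi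
  refine ⟨by omega, by omega, ?_⟩
  unfold slot
  split_ifs with h1
  · have h2 := (Finset.mem_filter.1 h1).2
    exact ⟨by omega, by omega, Or.inr (by omega)⟩
  · exact ⟨by omega, le_rfl, Or.inl rfl⟩

/-- The base cycles of the design given by the choice `φ`, with auxiliary cycles `c`. -/
def designCycle (hv : v = (2 * h + 1) * (2 * n + 1)) (hh : 3 ≤ h) {ι : Type}
    (c : ι → BaseCycle v (2 * h + 1)) (φ : freeCols n → Fin 6 × Bool) :
    (Finset.Icc 1 n).erase 2 ⊕ ι → BaseCycle v (2 * h + 1) :=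
  Sum.elim (fun i => (colCycle hv hh (colOK_slot hh φ i.2)).signed (orient φ i)) c

theorem pow_le_NC_mul (hv : v = (2 * h + 1) * (2 * n + 1)) (hh : 3 ≤ h) (hn : 2 ≤ n) :
    12 ^ (n - 3) ≤ NC v (2 * h + 1) * v ^ 2 := by
  have : NeZero v := ⟨by rw [hv]; positivity⟩
  obtain ⟨ι, _, c, hlen, hzero, htwo, hend⟩ := exists_auxiliary hv hh hn
  let D := fun φ => translates (designCycle hv hh c φ)
  have hD : ∀ φ, IsCyclicDesign v (2 * h + 1) (D φ) := by
    intro φ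
    apply isCyclicDesign_translates (by omega)
    · rw [Fintype.sum_sum_type]
      have h1 : ∀ i, (designCycle hv hh c φ (Sum.inl i)).len = 2 * h + 1 :=
        fun i => BaseCycle.signed_len _ _
      have h2 : ∀ i, designCycle hv hh c φ (Sum.inr i) = c i := fun i => rfl
      simp only [h1, h2, Finset.sum_const, Finset.card_univ, Fintype.card_coe, smul_eq_mul]
      rw [Finset.card_erase_of_mem (by simp [hn]), Nat.card_Icc, mul_add, hlen, hv]
      obtain ⟨m, rfl⟩ : ∃ m, n = m + 1 := ⟨n - 1, by omega⟩
      have h3 : (2 * h + 1) * (2 * (m + 1) + 1) = 2 * (m * (2 * h + 1)) + 3 * (2 * h + 1) := by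
        ring
      rw [h3, show m + 1 + 1 - 1 - 1 = m by omega]
      omega
    · intro d hd
      refine exists_covers_of_columns hv (fun s hs => ?_) (fun i hi hin x hx => ?_)
        (fun i hi hin => ?_) hd
      · obtain ⟨a, ha⟩ := hzero s hs
        exact ⟨Sum.inr a, ha⟩
      · by_cases hi2 : i = 2
        · obtain ⟨a, ha⟩ := htwo x hx
          exact ⟨Sum.inr a, by rw [hi2]; exact ha⟩
        · exact ⟨Sum.inl ⟨i, by simp [hi2, hi, hin]⟩, (colCycle_covers hv hh _ hx).signed _⟩
      · by_cases hi2 : i = 2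
        · obtain ⟨a, ha⟩ := hend
          exact ⟨Sum.inr a, by rw [hi2]; exact ha⟩
        · exact ⟨Sum.inl ⟨i, by simp [hi2, hi, hin]⟩, (colCycle_covers_colEnd hv hh _).signed _⟩
  have hmem : ∀ φ i (hi : i ∈ (Finset.Icc 1 n).erase 2) z,
      translateBlock ((colCycle hv hh (colOK_slot hh φ hi)).signed (orient φ i)).block z ∈ D φ :=
    fun φ i hi z => ⟨Sum.inl ⟨i, hi⟩, z, rfl⟩
  have hinj : Function.Injective D := by
    intro φ φ' hφ
    funext ⟨i, hi⟩
    have hi' := Finset.mem_filter.1 hi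
    have hi'' := Finset.mem_Icc.1 hi'.1
    have hic : i ∈ (Finset.Icc 1 n).erase 2 := by
      simp only [Finset.mem_erase, Finset.mem_Icc]
      omega
    obtain ⟨h1, h2⟩ := colCycle_params_eq hv hh (by omega) (by omega) (by omega) (hD φ).1
      (colOK_slot hh φ hic) (colOK_slot hh φ' hic) (hmem φ i hic) (by rw [hφ]; exact hmem φ' i hic)
    simp only [slot, orient, dif_pos hi] at h1 h2
    exact Prod.ext (Fin.ext (by omega)) h2
  have hrigid : ∀ φ, ∃ x y, ∀ f : ZMod v ≃ ZMod v, mapBlocks f (D φ) = D φ → f x = x → f y = y →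
      f = Equiv.refl _ := by
    intro φ
    refine ⟨colPath v h n 1 (2 * h - 3), colPath v h n 1 (2 * h - 2), fun f hf hx hy => ?_⟩
    have h1 : 1 ∈ (Finset.Icc 1 n).erase 2 := by
      simp only [Finset.mem_erase, Finset.mem_Icc]
      omega
    have hfree : 1 ∉ freeCols n := by simp [freeCols]
    have hok : ColOK h n 1 (2 * h) := ⟨by omega, by omega, by omega, le_rfl, Or.inl rfl⟩
    refine eq_refl_of_fixes_colCycle hv hh (hD φ).1 hok (fun z => ?_) hf hx hy
    have h2 := hmem φ 1 h1 z
    have h3 : slot h φ 1 = 2 * h := dif_neg hfree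
    have h4 : orient φ 1 = false := dif_neg hfree
    simp only [h3, h4] at h2
    exact h2
  have hcard := card_le_NC_mul D hD hinj hrigid
  rw [Nat.card_fun, Nat.card_prod, Nat.card_eq_fintype_card, Nat.card_eq_fintype_card,
    Nat.card_eq_fintype_card, Fintype.card_fin, Fintype.card_bool, Fintype.card_coe] at hcard
  exact (Nat.pow_le_pow_right (by norm_num) (card_freeCols n)).trans hcard

end Construction

theorem exists_growth_bound : ∃ N : ℕ, ∀ n ≥ N,
    ((3.35 : ℝ) ^ n) ^ 2 * (2 * n + 1) ^ 2 ≤ 12 ^ (n - 3) := by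
  have h1 := tendsto_pow_const_mul_const_pow_of_abs_lt_one 2
    (show |(11.2225 / 12 : ℝ)| < 1 by rw [abs_of_pos] <;> norm_num)
  obtain ⟨N, hN⟩ := Filter.eventually_atTop.1
    (h1.eventually_le_const (show (0 : ℝ) < 1 / (9 * 12 ^ 3) by norm_num))
  refine ⟨max N 3, fun n hn => ?_⟩
  have h2 := hN n ((le_max_left _ _).trans hn)
  have h3 : 3 ≤ n := (le_max_right _ _).trans hn
  have h4 : ((2 * n + 1) ^ 2 : ℝ) ≤ 9 * n ^ 2 := by
    have : (3 : ℝ) ≤ n := by exact_mod_cast h3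
    nlinarith
  have h5 : ((3.35 : ℝ) ^ n) ^ 2 = 11.2225 ^ n := by
    rw [← pow_mul, mul_comm, pow_mul]
    norm_num
  rw [div_pow, ← mul_div_assoc, div_le_div_iff₀ (by positivity) (by positivity), one_mul] at h2
  have h6 : (12 : ℝ) ^ n = 12 ^ (n - 3) * 12 ^ 3 := by rw [← pow_add, Nat.sub_add_cancel h3]
  have h7 : (0 : ℝ) ≤ 11.2225 ^ n := by positivity
  rw [h5]
  have h8 := mul_le_mul_of_nonneg_left h4 h7
  rw [h6] at h2
  nlinarith

theorem pow_div_le_NC {n k : ℕ} (hk : Odd k) (hk5 : 5 < k) (hn : 2 ≤ n)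
    (hgrowth : ((3.35 : ℝ) ^ n) ^ 2 * (2 * n + 1) ^ 2 ≤ 12 ^ (n - 3)) :
    (3.35 : ℝ) ^ n / k ≤ NC (2 * n * k + k) k := by
  obtain ⟨h, rfl⟩ := hk
  have h1 := pow_le_NC_mul (show 2 * n * (2 * h + 1) + (2 * h + 1) = (2 * h + 1) * (2 * n + 1) by
    ring) (by omega) hn
  generalize hv : 2 * n * (2 * h + 1) + (2 * h + 1) = v at *
  have hv' : (v : ℝ) = (2 * h + 1 : ℕ) * (2 * n + 1) := by
    rw [← hv]
    push_cast
    ring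
  have hkpos : (0 : ℝ) < (2 * h + 1 : ℕ) := by positivity
  generalize hC : NC v (2 * h + 1) = C at *
  generalize 2 * h + 1 = k at *
  rcases le_total ((3.35 : ℝ) ^ n) k with h2 | h2
  · have h3 : 1 ≤ C := by
      rw [Nat.one_le_iff_ne_zero]
      rintro rfl
      rw [zero_mul] at h1
      exact absurd h1 (by simp)
    calc (3.35 : ℝ) ^ n / k ≤ 1 := (div_le_one hkpos).2 h2
      _ ≤ C := by exact_mod_cast h3
  · have h3 : (12 : ℝ) ^ (n - 3) ≤ C * v ^ 2 := by exact_mod_cast h1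
    have h4 : ((3.35 : ℝ) ^ n) ^ 2 ≤ C * k ^ 2 := by
      rw [hv', mul_pow, ← mul_assoc] at h3
      exact le_of_mul_le_mul_right (hgrowth.trans h3) (by positivity)
    rw [div_le_iff₀ hkpos]
    have h5 : (3.35 : ℝ) ^ n * k ≤ C * k * k := by nlinarith
    exact le_of_mul_le_mul_right h5 hkpos

end CCS

/-- There is `N` such that for every odd `k > 5` and every `n ≥ N`
with `n ≡ 3, 5, 24, 26 (mod 28)`, `NC(2nk+k, k) ≥ 3.35^n / k`. -/
theorem stmt15 : ∃ N : ℕ, ∀ k n : ℕ, Odd k → 5 < k → N ≤ n →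
    (n % 28 = 3 ∨ n % 28 = 5 ∨ n % 28 = 24 ∨ n % 28 = 26) →
    (3.35 : ℝ) ^ n / (k : ℝ) ≤ (CCS.NC (2 * n * k + k) k : ℝ) := by
  obtain ⟨N, hN⟩ := CCS.exists_growth_bound
  exact ⟨max N 2, fun k n hk hk5 hn _ => CCS.pow_div_le_NC hk hk5 ((le_max_right _ _).trans hn)
    (hN n ((le_max_left _ _).trans hn))⟩
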